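/- arXiv:1812.11768 — 3 statements merged into one kernel-verified Lean document; each statement's English description precedes it below -/
import Mathlib

section
/- Suppose κ is a singular cardinal, λ > κ is a regular cardinal, (λ⁺,λ) ↠ (κ⁺,κ), and μ is a cardinal with cf(κ) ≤ μ < κ. Then (κ⁺,κ) ↠_{cf(κ)} (μ⁺,μ) fails. Consequently, if in addition μ^{<cf(κ)} = μ, then (κ⁺,κ) ↠ (μ⁺,μ) fails. -/
open Cardinal Ordinal

/-- Chang's Conjecture `(κ₁,κ₀) ↠ (μ₁,μ₀)`: every structure in a countable first-order
language on the set of ordinals below the initial ordinal of `κ₁` has a substructure of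
cardinality `μ₁` whose intersection with the ordinals below the initial ordinal of `κ₀`
has cardinality `μ₀`. -/
def ChangCC (κ₁ κ₀ μ₁ μ₀ : Cardinal.{0}) : Prop :=
  ∀ (L : FirstOrder.Language.{0,0}) (_ : Countable L.Symbols) (_ : L.Structure (Set.Iio κ₁.ord)),
    ∃ B : L.Substructure (Set.Iio κ₁.ord),
      #B = Cardinal.lift.{1,0} μ₁ ∧
      #{x : Set.Iio κ₁.ord // x ∈ B ∧ x.val < κ₀.ord} = Cardinal.lift.{1,0} μ₀

/-- Chang's Conjecture with subscript, `(κ₁,κ₀) ↠_ν (μ₁,μ₀)`: additionally the substructure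
contains every ordinal below the initial ordinal of `ν`. -/
def ChangCCSub (κ₁ κ₀ μ₁ μ₀ ν : Cardinal.{0}) : Prop :=
  ∀ (L : FirstOrder.Language.{0,0}) (_ : Countable L.Symbols) (_ : L.Structure (Set.Iio κ₁.ord)),
    ∃ B : L.Substructure (Set.Iio κ₁.ord),
      #B = Cardinal.lift.{1,0} μ₁ ∧
      #{x : Set.Iio κ₁.ord // x ∈ B ∧ x.val < κ₀.ord} = Cardinal.lift.{1,0} μ₀ ∧
      ∀ x : Set.Iio κ₁.ord, x.val < ν.ord → x ∈ B


inductive GFun : ℕ → Type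
  | f (b : Bool) : GFun 2

def GLang : FirstOrder.Language.{0,0} := ⟨GFun, fun _ => Empty⟩

theorem GLang_countable : Countable GLang.Symbols := by
  have h1 : Countable (Σ n, GFun n) := by
    refine Function.Surjective.countable (f := fun b : Bool => (⟨2, GFun.f b⟩ : Σ n, GFun n)) ?_
    rintro ⟨_, ⟨b⟩⟩
    exact ⟨b, rfl⟩
  have h2 : Countable (Σ _ : ℕ, Empty) := inferInstance
  have : Countable ((Σ n, GFun n) ⊕ (Σ _ : ℕ, Empty)) := inferInstance
  exact this

open Classical in
noncomputable def GStr (o : Ordinal.{0}) (F : Bool → Ordinal.{0} → Ordinal.{0} → Ordinal.{0}) :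
    GLang.Structure (Set.Iio o) where
  funMap := fun {n} φ => match n, φ with
    | _, GFun.f b => fun v => if h : F b (v 0).1 (v 1).1 < o then ⟨_, h⟩ else v 0
  RelMap := fun r => r.elim

theorem closure_aux (κ₁ κ₀ : Cardinal.{0}) (m₁ m₀ : Cardinal.{1}) (ν : Ordinal.{0})
    (F : Bool → Ordinal.{0} → Ordinal.{0} → Ordinal.{0})
    (hν : ν ≤ κ₁.ord)
    (h : letI := GStr κ₁.ord F; ∃ B : GLang.Substructure (Set.Iio κ₁.ord),
      #B = m₁ ∧
      #{x : Set.Iio κ₁.ord // x ∈ B ∧ x.val < κ₀.ord} = m₀ ∧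
      ∀ x : Set.Iio κ₁.ord, x.val < ν → x ∈ B) :
    ∃ B : Set Ordinal.{0}, B ⊆ Set.Iio κ₁.ord ∧ #B = m₁ ∧ #(B ∩ Set.Iio κ₀.ord : Set Ordinal.{0}) = m₀ ∧
      Set.Iio ν ⊆ B ∧ ∀ b, ∀ x ∈ B, ∀ y ∈ B, F b x y < κ₁.ord → F b x y ∈ B := by
  let _ := GStr κ₁.ord F
  obtain ⟨B, h1, h2, h3⟩ := h
  refine ⟨Subtype.val '' (B : Set (Set.Iio κ₁.ord)), ?_, ?_, ?_, ?_, ?_⟩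
  · rintro _ ⟨x, -, rfl⟩; exact x.2
  · rw [mk_image_eq Subtype.val_injective]; exact h1
  · rw [← h2]
    refine Cardinal.mk_congr ⟨fun x => ⟨⟨x.1, ?_⟩, ?_, x.2.2⟩, fun x => ⟨x.1.1, ⟨x.1, x.2.1, rfl⟩, x.2.2⟩, ?_, ?_⟩
    · obtain ⟨y, _, hy⟩ := x.2.1
      rw [← hy]; exact y.2
    · obtain ⟨y, hy', hy⟩ := x.2.1
      have : (⟨x.1, by rw [← hy]; exact y.2⟩ : Set.Iio κ₁.ord) = y := Subtype.ext hy.symm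
      rw [this]; exact hy'
    · intro x; rfl
    · intro x; rfl
  · intro x hx
    exact ⟨⟨x, lt_of_lt_of_le hx hν⟩, h3 _ hx, rfl⟩
  · rintro b _ ⟨x, hx, rfl⟩ _ ⟨y, hy, rfl⟩ hF
    refine ⟨⟨_, hF⟩, ?_, rfl⟩
    have := B.fun_mem (GFun.f b : GLang.Functions 2) ![x, y] (by
      intro i; fin_cases i
      · exact hx
      · exact hy)
    have e : FirstOrder.Language.Structure.funMap (L := GLang) (n := 2) (GFun.f b : GLang.Functions 2) ![x, y] = (⟨_, hF⟩ : Set.Iio κ₁.ord) := by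
      show (if h : F b x.1 y.1 < κ₁.ord then (⟨_, h⟩ : Set.Iio κ₁.ord) else x) = _
      rw [dif_pos hF]
    rw [e] at this
    exact this

theorem cc_closed {κ₁ κ₀ μ₁ μ₀ : Cardinal.{0}} (h : ChangCC κ₁ κ₀ μ₁ μ₀)
    (F : Bool → Ordinal.{0} → Ordinal.{0} → Ordinal.{0}) :
    ∃ B : Set Ordinal.{0}, B ⊆ Set.Iio κ₁.ord ∧ #B = Cardinal.lift.{1,0} μ₁ ∧
      #(B ∩ Set.Iio κ₀.ord : Set Ordinal.{0}) = Cardinal.lift.{1,0} μ₀ ∧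
      ∀ b, ∀ x ∈ B, ∀ y ∈ B, F b x y < κ₁.ord → F b x y ∈ B := by
  obtain ⟨B, h1, h2⟩ := h GLang GLang_countable (GStr κ₁.ord F)
  obtain ⟨B', a, b, c, d, e⟩ := closure_aux κ₁ κ₀ _ _ 0 F (zero_le) ⟨B, h1, h2, fun x hx => absurd hx (not_lt_zero)⟩
  exact ⟨B', a, b, c, e⟩

theorem ccsub_closed {κ₁ κ₀ μ₁ μ₀ ν : Cardinal.{0}} (h : ChangCCSub κ₁ κ₀ μ₁ μ₀ ν) (hν : ν ≤ κ₁)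
    (F : Bool → Ordinal.{0} → Ordinal.{0} → Ordinal.{0}) :
    ∃ B : Set Ordinal.{0}, B ⊆ Set.Iio κ₁.ord ∧ #B = Cardinal.lift.{1,0} μ₁ ∧
      #(B ∩ Set.Iio κ₀.ord : Set Ordinal.{0}) = Cardinal.lift.{1,0} μ₀ ∧ Set.Iio ν.ord ⊆ B ∧
      ∀ b, ∀ x ∈ B, ∀ y ∈ B, F b x y < κ₁.ord → F b x y ∈ B :=
  closure_aux κ₁ κ₀ _ _ ν.ord F (ord_le_ord.2 hν) (h GLang GLang_countable (GStr κ₁.ord F))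

theorem bdd_small {s : Set Ordinal.{0}} {a : Ordinal.{0}} (ha : #s < Cardinal.lift.{1,0} a.cof)
    (hs : ∀ i ∈ s, i < a) : ∃ b < a, ∀ i ∈ s, i < b := by
  rw [lift_cof] at ha
  refine ⟨_, sSup_add_one_lt_of_lt_cof ha hs, fun i hi => ?_⟩
  have : i + 1 ≤ sSup ((· + 1) '' s) := by
    refine le_csSup ⟨a, ?_⟩ ⟨i, hi, rfl⟩
    rintro _ ⟨j, hj, rfl⟩
    exact Order.add_one_le_of_lt (hs j hj)
  exact lt_of_lt_of_le (Order.lt_add_one_iff.2 le_rfl) this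

theorem mkIio (o : Ordinal.{0}) : #(Set.Iio o) = Cardinal.lift.{1,0} o.card := by
  exact Cardinal.mk_Iio_ordinal o

theorem enum_inj {c : Cardinal.{0}} {a : Ordinal.{0}} (ha : a < (Order.succ c).ord) :
    ∃ e : Ordinal.{0} → Ordinal.{0}, Set.InjOn e (Set.Iio a) ∧ ∀ x < a, e x < c.ord := by
  have h1 : #(Set.Iio a) ≤ #(Set.Iio c.ord) := by
    rw [mkIio, mkIio, Cardinal.lift_le, card_ord]
    exact Order.lt_succ_iff.1 (lt_ord.1 ha)
  obtain ⟨φ⟩ := h1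
  classical
  refine ⟨fun x => if h : x < a then φ ⟨x, h⟩ else 0, ?_, ?_⟩
  · intro x hx y hy h
    simp only [Set.mem_Iio] at hx hy
    simp only [hx, hy, dif_pos] at h
    have := φ.injective (Subtype.ext h)
    exact congrArg Subtype.val this
  · intro x hx
    simp only [hx, dif_pos]
    exact (φ ⟨x, hx⟩).2

theorem step1 (lam : Cardinal.{0}) (hreg : lam.IsRegular) :
    ∃ f g : Ordinal.{0} → Ordinal.{0} → Ordinal.{0},
      (∀ a < (Order.succ lam).ord, ∀ i < lam.ord, f a i < lam.ord) ∧
      (∀ b < (Order.succ lam).ord, ∀ a < b, g b a < lam.ord) ∧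
      ∀ b < (Order.succ lam).ord, ∀ a < b, ∀ a' < b, a ≠ a' → ∀ i < lam.ord,
        g b a ≤ i → g b a' ≤ i → f a i ≠ f a' i := by
  have he : ∀ a : Ordinal.{0}, ∃ e : Ordinal.{0} → Ordinal.{0}, a < (Order.succ lam).ord →
      Set.InjOn e (Set.Iio a) ∧ ∀ x < a, e x < lam.ord := by
    intro a
    by_cases ha : a < (Order.succ lam).ord
    · obtain ⟨e, h⟩ := enum_inj ha
      exact ⟨e, fun _ => h⟩
    · exact ⟨id, fun h => absurd h ha⟩
  choose e he using he
  have hcof : lam.ord.cof = lam := hreg.cof_ord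
  -- small sets
  have hsmall : ∀ a < (Order.succ lam).ord, ∀ i < lam.ord,
      #{x : Ordinal.{0} | x < a ∧ e a x < i} < Cardinal.lift.{1,0} lam := by
    intro a ha i hi
    have h1 : #{x : Ordinal.{0} | x < a ∧ e a x < i} ≤ #(Set.Iio i) := by
      refine Cardinal.mk_le_of_injective (f := fun x => ⟨e a x.1, x.2.2⟩) ?_
      intro x y h
      replace h := congrArg Subtype.val h
      exact Subtype.ext ((he a ha).1 x.2.1 y.2.1 h)
    refine h1.trans_lt ?_
    rw [mkIio, Cardinal.lift_lt]
    exact lt_ord.1 hi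
  let step : (a : Ordinal.{0}) → ((b : Ordinal.{0}) → b < a → Ordinal.{0} → Ordinal.{0}) → Ordinal.{0} → Ordinal.{0} :=
    fun a rec i => sInf {x | ∀ b (h : b < a), e a b < i → rec b h i ≠ x}
  let f : Ordinal.{0} → Ordinal.{0} → Ordinal.{0} := (wellFounded_lt (α := Ordinal.{0})).fix step
  have hf : ∀ a i, f a i = sInf {x | ∀ b, b < a → e a b < i → f b i ≠ x} := by
    intro a i
    show (wellFounded_lt (α := Ordinal.{0})).fix step a i = _
    rw [WellFounded.fix_eq]
  have hne : ∀ a < (Order.succ lam).ord, ∀ i < lam.ord,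
      ∃ x < lam.ord, ∀ b, b < a → e a b < i → f b i ≠ x := by
    intro a ha i hi
    by_contra! hcon
    have : #(Set.Iio lam.ord) ≤ #{x : Ordinal.{0} | x < a ∧ e a x < i} := by
      choose! φ h1 h2 h3 using hcon
      refine Cardinal.mk_le_of_injective (f := fun x => ⟨φ x.1, h1 x.1 x.2, h2 x.1 x.2⟩) ?_
      intro x y h
      replace h := congrArg Subtype.val h
      apply Subtype.ext
      have h' : φ x.1 = φ y.1 := h
      rw [← h3 x.1 x.2, ← h3 y.1 y.2, h']
    rw [mkIio, card_ord] at this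
    exact absurd (hsmall a ha i hi) this.not_gt
  have hf1 : ∀ a < (Order.succ lam).ord, ∀ i < lam.ord, f a i < lam.ord := by
    intro a ha i hi
    obtain ⟨x, hx, hx'⟩ := hne a ha i hi
    rw [hf]
    exact (csInf_le' (s := {x | ∀ b, b < a → e a b < i → f b i ≠ x}) hx').trans_lt hx
  have hf2 : ∀ a < (Order.succ lam).ord, ∀ i < lam.ord, ∀ b < a, e a b < i → f b i ≠ f a i := by
    intro a ha i hi
    obtain ⟨x, hx, hx'⟩ := hne a ha i hi
    have := csInf_mem (s := {x | ∀ b, b < a → e a b < i → f b i ≠ x}) ⟨x, hx'⟩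
    rw [← hf] at this
    exact this
  classical
  let D : Ordinal.{0} → Ordinal.{0} → Ordinal.{0} := fun a b => if b < a then e a b else e b a
  have hD : ∀ a < (Order.succ lam).ord, ∀ b < (Order.succ lam).ord, a ≠ b →
      D a b < lam.ord ∧ ∀ i < lam.ord, D a b < i → f a i ≠ f b i := by
    intro a ha b hb hab
    by_cases h : b < a
    · simp only [D, if_pos h]
      exact ⟨(he a ha).2 b h, fun i hi hlt => (hf2 a ha i hi b h hlt).symm⟩
    · simp only [D, if_neg h]
      have h' : a < b := lt_of_le_of_ne (not_lt.1 h) hab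
      exact ⟨(he b hb).2 a h', fun i hi hlt => (hf2 b hb i hi a h' hlt)⟩
  have hg : ∀ b a : Ordinal.{0}, ∃ y : Ordinal.{0}, b < (Order.succ lam).ord → a < b →
      y < lam.ord ∧ ∀ a' < b, e b a' < e b a → D a a' < y := by
    intro b a
    by_cases hb : b < (Order.succ lam).ord
    · by_cases hab : a < b
      · have hs := hsmall b hb (e b a) ((he b hb).2 a hab)
        obtain ⟨y, hy, hy'⟩ := bdd_small (s := D a '' {x : Ordinal.{0} | x < b ∧ e b x < e b a}) (a := lam.ord)
          (by rw [hcof]; exact mk_image_le.trans_lt hs) (by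
            rintro _ ⟨x, ⟨hx, hx'⟩, rfl⟩
            refine (hD a (hab.trans hb) x (hx.trans hb) ?_).1
            rintro rfl
            exact lt_irrefl _ hx')
        exact ⟨y, fun _ _ => ⟨hy, fun a' h1 h2 => hy' _ ⟨a', ⟨h1, h2⟩, rfl⟩⟩⟩
      · exact ⟨0, fun _ h => absurd h hab⟩
    · exact ⟨0, fun h => absurd h hb⟩
  choose g hg using hg
  refine ⟨f, g, hf1, fun b hb a ha => (hg b a hb ha).1, ?_⟩
  intro b hb
  have key : ∀ a < b, ∀ a' < b, e b a' < e b a → ∀ i < lam.ord, g b a ≤ i → f a i ≠ f a' i := by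
    intro a ha a' ha' hlt i hi hgi
    refine (hD a (ha.trans hb) a' (ha'.trans hb) ?_).2 i hi (((hg b a hb ha).2 a' ha' hlt).trans_le hgi)
    rintro rfl
    exact lt_irrefl _ hlt
  intro a ha a' ha' hne i hi h1 h2
  rcases lt_trichotomy (e b a) (e b a') with h | h | h
  · exact (key a' ha' a ha h i hi h2).symm
  · exact absurd ((he b hb).1 ha ha' h) hne
  · exact key a ha a' ha' h i hi h1

/-- The transferred family. -/
def Fam (κ θ : Cardinal.{0}) (h : Ordinal.{0} → Ordinal.{0} → Ordinal.{0}) : Prop :=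
  (∀ a < (Order.succ κ).ord, ∀ i < θ.ord, h a i < κ.ord) ∧
  ∀ b < (Order.succ κ).ord, ∃ G : Ordinal.{0} → Ordinal.{0}, ∀ a < b, G a < θ.ord ∧
    ∀ a' < b, a ≠ a' → ∀ i < θ.ord, G a ≤ i → G a' ≤ i → h a i ≠ h a' i

theorem step2 (κ lam : Cardinal.{0}) (hlamreg : lam.IsRegular)
    (hcc : ChangCC (Order.succ lam) lam (Order.succ κ) κ) :
    ∃ θ h, θ ≤ κ ∧ θ.ord.cof = θ ∧ Fam κ θ h := by
  obtain ⟨f, g, hf, hg, hfg⟩ := step1 lam hlamreg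
  obtain ⟨B, hB1, hB2, hB3, hB4⟩ := cc_closed hcc (fun b => if b then f else g)
  have hBf : ∀ x ∈ B, ∀ y ∈ B, f x y < (Order.succ lam).ord → f x y ∈ B := fun x hx y hy => by
    simpa using hB4 true x hx y hy
  have hBg : ∀ x ∈ B, ∀ y ∈ B, g x y < (Order.succ lam).ord → g x y ∈ B := fun x hx y hy => by
    simpa using hB4 false x hx y hy
  have hll : lam.ord ≤ (Order.succ lam).ord := ord_le_ord.2 (Order.le_succ _)
  set X : Set Ordinal.{0} := B ∩ Set.Iio lam.ord with hX
  -- order embedding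
  have hj : Nonempty (InitialSeg ((· < ·) : Set.Iio (Order.succ κ).ord → _ → Prop) ((· < ·) : B → B → Prop)) := by
    rw [← Ordinal.type_le_iff, type_lt_Iio, lift_ord, ← hB2]
    exact ord_le_type _
  obtain ⟨j⟩ := hj
  have hjlt : ∀ x y : Set.Iio (Order.succ κ).ord, x < y → j x < j y := fun x y hxy => j.map_rel_iff.2 hxy
  obtain ⟨θ, hθ⟩ : ∃ θ : Cardinal.{0}, Cardinal.lift.{1,0} θ = Order.cof X := by
    have : Order.cof X ≤ Cardinal.lift.{1,0} κ := hB3 ▸ Order.cof_le_cardinalMk X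
    obtain ⟨θ, hθ⟩ := Cardinal.mem_range_lift_of_le this
    exact ⟨θ, hθ⟩
  obtain ⟨D, hD, hD'⟩ := exists_ord_cof_eq X
  have hc : Nonempty (((· < ·) : Set.Iio θ.ord → _ → Prop) ≃r ((· < ·) : D → D → Prop)) := by
    rw [← Ordinal.type_eq, type_lt_Iio, lift_ord, hθ, hD']
  obtain ⟨c⟩ := hc
  have hcle : ∀ x y, x ≤ y → c x ≤ c y := by
    intro x y hxy
    by_contra hlt
    exact absurd (c.map_rel_iff.1 (not_le.1 hlt)) hxy.not_gt
  have hp : Nonempty (X ≃ Set.Iio κ.ord) := by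
    rw [← Cardinal.eq, hB3, mkIio, card_ord]
  obtain ⟨p⟩ := hp
  have hfX : ∀ a ∈ B, ∀ i ∈ X, f a i ∈ X := by
    intro a ha i hi
    have := hf a (hB1 ha) i hi.2
    exact ⟨hBf a ha i hi.1 (this.trans_le hll), this⟩
  classical
  refine ⟨θ, fun a i => if ha : a < (Order.succ κ).ord then if hi : i < θ.ord then
    (p ⟨f (j ⟨a, ha⟩) (c ⟨i, hi⟩).1, hfX _ (j ⟨a, ha⟩).2 _ (c ⟨i, hi⟩).1.2⟩).1 else 0 else 0, ?_, ?_, ?_, ?_⟩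
  · rw [← Cardinal.lift_le.{1}, hθ, ← hB3]
    exact Order.cof_le_cardinalMk X
  · rw [← Cardinal.lift_inj.{0,1}, lift_cof, lift_ord, hθ, Order.cof_ord_cof]
  · intro a ha i hi
    simp only [dif_pos ha, dif_pos hi]
    exact (p _).2
  · intro b hb
    have hG : ∀ a : Ordinal.{0}, ∃ γ : Ordinal.{0}, ∀ h : a < b, ∃ hγ : γ < θ.ord,
        g (j ⟨b, hb⟩) (j ⟨a, h.trans hb⟩) ≤ (c ⟨γ, hγ⟩).1 := by
      intro a
      by_cases hab : a < b
      · have hlt : ((j ⟨a, hab.trans hb⟩ : B) : Ordinal.{0}) < (j ⟨b, hb⟩ : B) := hjlt _ _ hab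
        have h1 : g (j ⟨b, hb⟩) (j ⟨a, hab.trans hb⟩) < lam.ord :=
          hg _ (hB1 (j _).2) _ hlt
        obtain ⟨y, hy, hy'⟩ := hD ⟨_, hBg _ (j ⟨b, hb⟩).2 _ (j ⟨a, hab.trans hb⟩).2 (h1.trans_le hll), h1⟩
        refine ⟨c.symm ⟨y, hy⟩, fun _ => ⟨(c.symm ⟨y, hy⟩).2, ?_⟩⟩
        simp only [Subtype.coe_eta, RelIso.apply_symm_apply]
        exact hy'
      · exact ⟨0, fun h => absurd h hab⟩
    choose G hG using hG
    refine ⟨G, fun a ha => ⟨(hG a ha).1, ?_⟩⟩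
    intro a' ha' hne i hi h1 h2
    have ha1 := ha.trans hb
    have ha1' := ha'.trans hb
    simp only [dif_pos ha1, dif_pos ha1', dif_pos hi]
    intro heq
    have heq2 := p.injective (Subtype.ext heq)
    replace heq2 := congrArg Subtype.val heq2
    refine hfg (j ⟨b, hb⟩) (hB1 (j _).2) (j ⟨a, ha1⟩) (hjlt _ _ ha) (j ⟨a', ha1'⟩) (hjlt _ _ ha') ?_ _
      (c ⟨i, hi⟩).1.2.2 ?_ ?_ heq2
    · intro h
      have := j.injective (Subtype.ext h)
      exact hne (congrArg Subtype.val this)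
    · exact (hG a ha).2.trans (hcle _ _ h1)
    · exact (hG a' ha').2.trans (hcle _ _ h2)

theorem fam_count {κ θ : Cardinal.{0}} (hκ : ℵ₀ ≤ κ) {h : Ordinal.{0} → Ordinal.{0} → Ordinal.{0}}
    (hF : Fam κ θ h) (S I Y : Set Ordinal.{0}) (hS : S ⊆ Set.Iio (Order.succ κ).ord)
    (hSc : #S ≤ Cardinal.lift.{1,0} κ) (hI : I ⊆ Set.Iio θ.ord)
    (hh : ∀ a ∈ S, ∀ γ < θ.ord, ∃ i ∈ I, γ ≤ i ∧ h a i ∈ Y) :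
    #S ≤ #I * #Y := by
  obtain ⟨b, hb, hSb⟩ := bdd_small (s := S) (a := (Order.succ κ).ord) (by
    rw [(isRegular_succ hκ).cof_ord]
    exact hSc.trans_lt (Cardinal.lift_lt.2 (Order.lt_succ κ))) (fun i hi => hS hi)
  obtain ⟨G, hG⟩ := hF.2 b hb
  have : ∀ a : S, ∃ i ∈ I, G a ≤ i ∧ h a i ∈ Y := fun a => hh a a.2 _ (hG a (hSb a a.2)).1
  choose i hi1 hi2 hi3 using this
  rw [Cardinal.mul_def]
  refine Cardinal.mk_le_of_injective (f := fun a : S => ((⟨i a, hi1 a⟩, ⟨h a (i a), hi3 a⟩) : I × Y)) ?_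
  intro a a' heq
  have e1 : i a = i a' := congrArg (fun z => z.1.1) heq
  have e2 : h a (i a) = h a' (i a') := congrArg (fun z => z.2.1) heq
  by_contra hne
  refine (hG a (hSb a a.2)).2 a' (hSb a' a'.2) (fun h => hne (Subtype.ext h)) (i a) (hI (hi1 a)) (hi2 a)
    (e1 ▸ hi2 a') ?_
  rw [e2, e1]

theorem step3 {κ θ : Cardinal.{0}} (hκ : ℵ₀ ≤ κ) (hsing : κ.ord.cof < κ)
    {h : Ordinal.{0} → Ordinal.{0} → Ordinal.{0}} (hθκ : θ ≤ κ) (hθ : θ.ord.cof = θ)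
    (hF : Fam κ θ h) : θ = κ.ord.cof := by
  have hlt : θ < κ := by
    refine lt_of_le_of_ne hθκ ?_
    rintro rfl
    exact hsing.ne hθ
  by_contra hne
  have claim : ∀ a : Set.Iio (Order.succ κ).ord, ∃ ν : Set.Iio κ.ord, ∀ γ < θ.ord, ∃ i < θ.ord, γ ≤ i ∧ h a i < ν.1 := by
    rintro ⟨a, ha⟩
    rcases lt_or_gt_of_ne hne with hl | hl
    · obtain ⟨ν, hν, hν'⟩ := bdd_small (s := h a '' Set.Iio θ.ord) (a := κ.ord) (by
        refine mk_image_le.trans_lt ?_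
        rw [mkIio, card_ord]
        exact Cardinal.lift_lt.2 hl) (by
        rintro _ ⟨i, hi, rfl⟩
        exact hF.1 a ha i hi)
      exact ⟨⟨ν, hν⟩, fun γ hγ => ⟨γ, hγ, le_rfl, hν' _ ⟨γ, hγ, rfl⟩⟩⟩
    · by_contra! hcon
      obtain ⟨T, hT, hT'⟩ := Order.exists_cof_eq (Set.Iio κ.ord)
      rw [cof_Iio, ← lift_cof] at hT'
      choose! γ hγ1 hγ2 using hcon
      have hsucc : ∀ t < κ.ord, Order.succ t < κ.ord := fun t ht =>
        (isSuccLimit_ord hκ).succ_lt ht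
      let γ' : Set.Iio κ.ord → Ordinal.{0} := fun t => γ ⟨Order.succ t.1, hsucc t.1 t.2⟩
      obtain ⟨δ, hδ, hδ'⟩ := bdd_small (s := γ' '' T) (a := θ.ord) (by
        refine mk_image_le.trans_lt ?_
        rw [hT', hθ]
        exact Cardinal.lift_lt.2 hl) (by
        rintro _ ⟨t, ht, rfl⟩
        exact hγ1 _)
      obtain ⟨t, ht, ht'⟩ := hT ⟨h a δ, hF.1 a ha δ hδ⟩
      have := hγ2 ⟨Order.succ t.1, hsucc t.1 t.2⟩ δ hδ (hδ' _ ⟨t, ht, rfl⟩).le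
      exact absurd (Order.succ_le_iff.1 this) (not_lt.2 ht')
  choose ν hν using claim
  have c1 : #(Set.Iio κ.ord) = Cardinal.lift.{1,0} κ := by rw [mkIio, card_ord]
  have c2 : #(Set.Iio (Order.succ κ).ord) = Cardinal.lift.{1,0} (Order.succ κ) := by rw [mkIio, card_ord]
  obtain ⟨v, hv⟩ := infinite_pigeonhole_card_lt ν
    (by rw [c1, c2]; exact Cardinal.lift_lt.2 (Order.lt_succ κ))
    (by rw [c2]; exact aleph0_le_lift.2 (hκ.trans (Order.le_succ κ)))
  rw [c1, ← mk_image_eq (f := Subtype.val) Subtype.val_injective] at hv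
  obtain ⟨S, hS, hSc⟩ := le_mk_iff_exists_subset.1 hv.le
  have := fam_count hκ hF S (Set.Iio θ.ord) (Set.Iio v.1) (by
    intro x hx
    obtain ⟨y, _, rfl⟩ := hS hx
    exact y.2) hSc.le subset_rfl (by
    intro a ha γ hγ
    obtain ⟨y, hy, rfl⟩ := hS ha
    obtain ⟨i, hi, h1, h2⟩ := hν y γ hγ
    have hy' : ν y = v := hy
    rw [hy'] at h2
    exact ⟨i, hi, h1, h2⟩)
  rw [hSc, mkIio, mkIio, ← Cardinal.lift_mul, Cardinal.lift_le, card_ord] at this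
  exact absurd (mul_lt_of_lt hκ hlt (lt_ord.1 v.2)) this.not_gt

theorem gcc_impossible (κ lam μ : Cardinal.{0})
    (hκ : ℵ₀ ≤ κ) (hκsing : κ.ord.cof < κ)
    (hlam : κ < lam) (hlamreg : lam.IsRegular)
    (hcc : ChangCC (Order.succ lam) lam (Order.succ κ) κ)
    (hμ₁ : κ.ord.cof ≤ μ) (hμ₂ : μ < κ) :
    ¬ ChangCCSub (Order.succ κ) κ (Order.succ μ) μ κ.ord.cof ∧
    (μ ^< κ.ord.cof = μ → ¬ ChangCC (Order.succ κ) κ (Order.succ μ) μ) := by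
  obtain ⟨θ, h, hθκ, hθ, hF⟩ := step2 κ lam hlamreg hcc
  have hθeq := step3 hκ hκsing hθκ hθ hF
  rw [← hθeq] at hμ₁ ⊢
  have hθ0 : ℵ₀ ≤ θ := by
    rw [hθeq, aleph0_le_cof_iff, one_lt_cof_iff]
    exact isSuccLimit_ord hκ
  have hμ0 : ℵ₀ ≤ μ := hθ0.trans hμ₁
  have hθs : θ ≤ Order.succ κ := hθκ.trans (Order.le_succ κ)
  have hκs : κ.ord ≤ (Order.succ κ).ord := ord_le_ord.2 (Order.le_succ κ)
  have hθo : θ.ord ≤ κ.ord := ord_le_ord.2 hθκ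
  have hlt : μ < Order.succ μ := Order.lt_succ μ
  -- the main count
  have main : ∀ B : Set Ordinal.{0}, B ⊆ Set.Iio (Order.succ κ).ord →
      #B = Cardinal.lift.{1,0} (Order.succ μ) →
      #(B ∩ Set.Iio κ.ord : Set Ordinal.{0}) = Cardinal.lift.{1,0} μ →
      (∀ x ∈ B, ∀ y ∈ B, h x y < (Order.succ κ).ord → h x y ∈ B) →
      (∀ γ < θ.ord, ∃ i ∈ B ∩ Set.Iio θ.ord, γ ≤ i) → False := by
    intro B h1 h2 h3 h4 h5
    have := fam_count hκ hF B (B ∩ Set.Iio θ.ord) (B ∩ Set.Iio κ.ord) h1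
      (by rw [h2]; exact Cardinal.lift_le.2 (Order.succ_le_of_lt hμ₂)) Set.inter_subset_right (by
        intro a ha γ hγ
        obtain ⟨i, hi, hi'⟩ := h5 γ hγ
        have hlt := hF.1 a (h1 ha) i hi.2
        exact ⟨i, hi, hi', h4 a ha i hi.1 (hlt.trans_le hκs), hlt⟩)
    have h6 : #(B ∩ Set.Iio θ.ord : Set Ordinal.{0}) ≤ Cardinal.lift.{1,0} μ := by
      refine (mk_le_mk_of_subset Set.inter_subset_right).trans ?_
      rw [mkIio, card_ord]
      exact Cardinal.lift_le.2 hμ₁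
    have h7 := this.trans (mul_le_mul' h6 h3.le)
    rw [h2, ← Cardinal.lift_mul, Cardinal.lift_le, mul_eq_self hμ0] at h7
    exact absurd hlt h7.not_gt
  constructor
  · intro hcs
    obtain ⟨B, h1, h2, h3, h4, h5⟩ := ccsub_closed hcs hθs (fun _ => h)
    exact main B h1 h2 h3 (h5 true) (fun γ hγ => ⟨γ, ⟨h4 hγ, hγ⟩, le_rfl⟩)
  · intro hpow hcs
    have hdiff : ∀ a b : Ordinal.{0}, ∃ i, a < (Order.succ κ).ord → b < (Order.succ κ).ord → a ≠ b →
        i < θ.ord ∧ h a i ≠ h b i := by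
      intro a b
      by_cases hab : a < (Order.succ κ).ord ∧ b < (Order.succ κ).ord ∧ a ≠ b
      · obtain ⟨ha, hb, hne⟩ := hab
        have hm : Order.succ (max a b) < (Order.succ κ).ord :=
          (isSuccLimit_ord (hκ.trans (Order.le_succ κ))).succ_lt (max_lt ha hb)
        obtain ⟨G, hG⟩ := hF.2 _ hm
        have ha' : a < Order.succ (max a b) := Order.lt_succ_iff.2 (le_max_left _ _)
        have hb' : b < Order.succ (max a b) := Order.lt_succ_iff.2 (le_max_right _ _)
        have hi := max_lt (hG a ha').1 (hG b hb').1
        exact ⟨max (G a) (G b), fun _ _ _ => ⟨hi,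
          (hG a ha').2 b hb' hne _ hi (le_max_left _ _) (le_max_right _ _)⟩⟩
      · exact ⟨0, fun x y z => absurd ⟨x, y, z⟩ hab⟩
    choose d hd using hdiff
    obtain ⟨B, h1, h2, h3, h5⟩ := cc_closed hcs (fun b => if b then h else d)
    have hBh : ∀ x ∈ B, ∀ y ∈ B, h x y < (Order.succ κ).ord → h x y ∈ B := fun x hx y hy => by
      simpa using h5 true x hx y hy
    have hBd : ∀ x ∈ B, ∀ y ∈ B, d x y < (Order.succ κ).ord → d x y ∈ B := fun x hx y hy => by
      simpa using h5 false x hx y hy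
    by_cases hub : ∀ γ < θ.ord, ∃ i ∈ B ∩ Set.Iio θ.ord, γ ≤ i
    · exact main B h1 h2 h3 hBh hub
    · push Not at hub
      obtain ⟨γ, hγ, hγ'⟩ := hub
      have hI : #(B ∩ Set.Iio θ.ord : Set Ordinal.{0}) ≤ Cardinal.lift.{1,0} γ.card := by
        rw [← mkIio]
        exact mk_le_mk_of_subset (fun i hi => hγ' i hi)
      have hhB : ∀ a ∈ B, ∀ i ∈ B ∩ Set.Iio θ.ord, h a i ∈ B ∩ Set.Iio κ.ord := by
        intro a ha i hi
        have hlt := hF.1 a (h1 ha) i hi.2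
        exact ⟨hBh a ha i hi.1 (hlt.trans_le hκs), hlt⟩
      have hle : #B ≤ #((B ∩ Set.Iio θ.ord : Set Ordinal.{0}) → (B ∩ Set.Iio κ.ord : Set Ordinal.{0})) := by
        refine Cardinal.mk_le_of_injective (f := fun a i => ⟨h a.1 i.1, hhB a.1 a.2 i.1 i.2⟩) ?_
        intro a b hab
        by_contra hne
        have hne' : a.1 ≠ b.1 := fun h => hne (Subtype.ext h)
        obtain ⟨q1, q2⟩ := hd a.1 b.1 (h1 a.2) (h1 b.2) hne'
        have hdB : d a.1 b.1 ∈ B := hBd a.1 a.2 b.1 b.2 (q1.trans_le (hθo.trans hκs))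
        have := congrFun hab ⟨d a.1 b.1, hdB, q1⟩
        exact q2 (congrArg Subtype.val this)
      rw [← Cardinal.power_def, h2, h3] at hle
      have hμl : Cardinal.lift.{1,0} μ ≠ 0 := by
        rw [Ne, Cardinal.lift_eq_zero]
        exact (aleph0_pos.trans_le hμ0).ne'
      have := hle.trans (Cardinal.power_le_power_left hμl hI)
      rw [← Cardinal.lift_power, Cardinal.lift_le] at this
      have h8 := this.trans (le_powerlt μ (lt_ord.1 hγ))
      rw [hpow] at h8
      exact absurd hlt h8.not_gt
end

section
/- It is not the case that both (ℵ_{ω+2}, ℵ_{ω+1}) ↠ (ℵ_{ω+1}, ℵ_ω) and (ℵ_{ω+1}, ℵ_ω) ↠ (ℵ₁, ℵ₀) hold. In particular, it is not the case that (κ⁺,κ) ↠ (μ⁺,μ) holds for all infinite cardinals μ < κ ≤ ℵ_{ω+1} with cf(μ) ≤ cf(κ). -/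
open Cardinal Ordinal

universe u

theorem gcc_rank {T W : Type u} [LinearOrder W] (c : Cardinal.{u}) (R : T → T → Prop)
    (hR : WellFounded R)
    (hreg : ∀ s : Set W, #s < c → ∃ b, ∀ x ∈ s, x < b)
    (hc : ∀ y, #{x | R x y} < c) : ∃ f : T → W, ∀ x y, R x y → f x < f y := by
  classical
  by_cases hT : Nonempty T
  swap
  · exact ⟨fun x => (hT ⟨x⟩).elim, fun x => (hT ⟨x⟩).elim⟩
  have hpos : 0 < c := lt_of_le_of_lt zero_le (hc hT.some)
  obtain ⟨w0, -⟩ := hreg ∅ (by simpa using hpos)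
  have : ∀ s : Set W, ∃ b, #s < c → ∀ x ∈ s, x < b := by
    intro s
    by_cases h : #s < c
    · obtain ⟨b, hb⟩ := hreg s h
      exact ⟨b, fun _ => hb⟩
    · exact ⟨w0, fun h' => (h h').elim⟩
  choose ub hub using this
  let F : ∀ y, (∀ x, R x y → W) → W := fun y ih => ub (Set.range fun p : {x | R x y} => ih p.1 p.2)
  refine ⟨hR.fix F, fun x y hxy => ?_⟩
  rw [hR.fix_eq F y]
  exact hub _ (lt_of_le_of_lt mk_range_le (hc y)) _ ⟨⟨x, hxy⟩, rfl⟩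

/-- The relation generated by the bookkeeping maps `h`. -/
inductive GccBM {T W : Type u} [LT T] [LE W] (h : T → T → W) (ν : W) : T → T → Prop
  | base {x β : T} : x < β → h β x ≤ ν →
      (∀ y z, z < β → y < z → h β y ≤ h β x → h β z ≤ h β x → GccBM h ν y z) → GccBM h ν x β
  | trans {x y z : T} : GccBM h ν x y → GccBM h ν y z → GccBM h ν x z

def GccJ {T W : Type u} [LT T] [LE W] (h : T → T → W) (ν : W) (x β : T) : Prop :=
  x < β ∧ h β x ≤ ν ∧
      (∀ y z, z < β → y < z → h β y ≤ h β x → h β z ≤ h β x → GccBM h ν y z)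

section
variable {T W : Type u} [LinearOrder T] [LinearOrder W] {h : T → T → W}

theorem GccBM.lt {ν : W} {x y : T} (H : GccBM h ν x y) : x < y := by
  induction H with
  | base h1 _ _ _ => exact h1
  | trans _ _ h1 h2 => exact h1.trans h2

theorem GccBM.mono {ν ν' : W} (hν : ν ≤ ν') {x y : T} (H : GccBM h ν x y) : GccBM h ν' x y := by
  induction H with
  | base h1 h2 _ ih => exact .base h1 (h2.trans hν) ih
  | trans _ _ h1 h2 => exact h1.trans h2

theorem GccBM.exJ {ν : W} {x y : T} (H : GccBM h ν x y) :
    ∃ x', GccJ h ν x' y ∧ (x = x' ∨ GccBM h ν x x') := by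
  induction H with
  | @base x β h1 h2 h3 ih => exact ⟨x, ⟨h1, h2, h3⟩, .inl rfl⟩
  | trans H1 H2 h1 h2 =>
    obtain ⟨x', hx', hh⟩ := h2
    refine ⟨x', hx', .inr ?_⟩
    rcases hh with rfl | hh
    · exact H1
    · exact H1.trans hh

theorem GccBM.coh [WellFoundedLT T] {ν : W} {β : T} : ∀ {x y : T}, GccBM h ν x β → GccBM h ν y β →
    x < y → GccBM h ν x y := by
  induction β using WellFoundedLT.induction with
  | ind β IH =>
  intro x y Hx Hy hxy
  obtain ⟨x', Jx, hx⟩ := Hx.exJ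
  obtain ⟨y', Jy, hy⟩ := Hy.exJ
  have key : ∃ μ < β, (x = μ ∨ GccBM h ν x μ) ∧ (y = μ ∨ GccBM h ν y μ) := by
    have up : ∀ {a b c : T}, (a = b ∨ GccBM h ν a b) → GccBM h ν b c → GccBM h ν a c := by
      rintro a b c (rfl | h1) h2
      · exact h2
      · exact h1.trans h2
    rcases lt_trichotomy x' y' with hlt | heq | hlt
    · have : GccBM h ν x' y' := by
        rcases le_total (h β x') (h β y') with hh | hh
        · exact Jy.2.2 _ _ Jy.1 hlt hh le_rfl
        · exact Jx.2.2 _ _ Jy.1 hlt le_rfl hh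
      exact ⟨y', Jy.1, .inr (up hx this), hy⟩
    · subst heq
      exact ⟨x', Jx.1, hx, hy⟩
    · have : GccBM h ν y' x' := by
        rcases le_total (h β x') (h β y') with hh | hh
        · exact Jy.2.2 _ _ Jx.1 hlt le_rfl hh
        · exact Jx.2.2 _ _ Jx.1 hlt hh le_rfl
      exact ⟨x', Jx.1, hx, .inr (up hy this)⟩
  obtain ⟨μ, hμ, hx, hy⟩ := key
  rcases hy with rfl | hy
  · rcases hx with rfl | hx
    · exact (lt_irrefl _ hxy).elim
    · exact hx
  · rcases hx with rfl | hx
    · exact (lt_asymm hxy hy.lt).elim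
    · exact IH μ hμ hx hy hxy

theorem GccBM.small [WellFoundedLT T] {c : Cardinal.{u}} (hc : c.IsRegular)
    (hinj : ∀ β, Set.InjOn (h β) (Set.Iio β))
    (hI : ∀ ν : W, #(Set.Iic ν) < c) (ν : W) (β : T) : #{x | GccBM h ν x β} < c := by
  induction β using WellFoundedLT.induction with
  | ind β IH =>
  have hJ : #{x | GccJ h ν x β} < c := by
    refine lt_of_le_of_lt ?_ (hI ν)
    refine Cardinal.mk_le_of_injective (f := fun p : {x | GccJ h ν x β} => (⟨h β p.1, p.2.2.1⟩ : Set.Iic ν)) ?_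
    intro p q hpq
    exact Subtype.ext (hinj β p.2.1 q.2.1 (congrArg Subtype.val hpq))
  have hsub : {x | GccBM h ν x β} ⊆
      ⋃ a ∈ {x | GccJ h ν x β}, insert a {x | GccBM h ν x a} := by
    intro x hx
    obtain ⟨x', h1, h2⟩ := GccBM.exJ hx
    simp only [Set.mem_iUnion]
    exact ⟨x', h1, h2⟩
  refine (mk_le_mk_of_subset hsub).trans_lt ?_
  rw [card_biUnion_lt_iff_forall_of_isRegular hc hJ]
  intro a ha
  refine (mk_insert_le).trans_lt ?_
  exact Cardinal.add_lt_of_lt hc.aleph0_le (IH a ha.1) (lt_of_lt_of_le one_lt_aleph0 hc.aleph0_le)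

theorem GccBM.cover [WellFoundedLT T] {c : Cardinal.{u}} (hc : c.IsRegular)
    (hinj : ∀ β, Set.InjOn (h β) (Set.Iio β))
    (hreg : ∀ s : Set W, #s < c → ∃ b, ∀ x ∈ s, x < b)
    (hI : ∀ ν : W, #(Set.Iic ν) < c) (β : T) : ∀ x < β, ∃ ν, GccBM h ν x β := by
  induction β using WellFoundedLT.induction with
  | ind β IH =>
  intro x hx
  let S := {y | y < β ∧ h β y ≤ h β x}
  have hS : #S < c := by
    refine lt_of_le_of_lt ?_ (hI (h β x))
    refine Cardinal.mk_le_of_injective (f := fun p : S => (⟨h β p.1, p.2.2⟩ : Set.Iic (h β x))) ?_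
    intro p q hpq
    exact Subtype.ext (hinj β p.2.1 q.2.1 (congrArg Subtype.val hpq))
  have hex : ∀ p : S × S, ∃ ν, p.1.1 < p.2.1 → GccBM h ν p.1.1 p.2.1 := by
    intro p
    by_cases hp : p.1.1 < p.2.1
    · obtain ⟨ν, hν⟩ := IH p.2.1 p.2.2.1 _ hp
      exact ⟨ν, fun _ => hν⟩
    · exact ⟨h β x, fun h' => (hp h').elim⟩
  choose N hN using hex
  obtain ⟨b, hb⟩ := hreg (Set.range N) (mk_range_le.trans_lt (by
    rw [Cardinal.mk_prod]
    simpa using Cardinal.mul_lt_of_lt hc.aleph0_le hS hS))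
  refine ⟨max b (h β x), .base hx (le_max_right _ _) ?_⟩
  intro y z hz hyz h1 h2
  refine (hN (⟨y, hyz.trans hz, h1⟩, ⟨z, hz, h2⟩) hyz).mono ?_
  exact (hb _ ⟨_, rfl⟩).le.trans (le_max_left _ _)

theorem gcc_rho [WellFoundedLT T] [WellFoundedLT W] {c : Cardinal.{u}} (hc : c.IsRegular)
    (hW : #W = c) (hT : ∀ β : T, #(Set.Iio β) ≤ c)
    (hreg : ∀ s : Set W, #s < c → ∃ b, ∀ x ∈ s, x < b)
    (hI : ∀ ν : W, #(Set.Iic ν) < c) :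
    ∃ (ρ : T → T → W) (g : T → W → W),
      (∀ x y z i, x < y → y < z → ρ x z ≤ i → ρ y z ≤ i → ρ x y ≤ i) ∧
      (∀ x y i, x < y → ρ x y ≤ i → g x i < g y i) := by
  classical
  have hWne : Nonempty W := by
    rw [← mk_ne_zero_iff, hW]; exact hc.ne_zero
  have : ∀ β : T, ∃ f : T → W, Set.InjOn f (Set.Iio β) := by
    intro β
    have := hT β
    rw [← hW, Cardinal.le_def] at this
    obtain ⟨e⟩ := this
    refine ⟨fun x => if hx : x < β then e ⟨x, hx⟩ else hWne.some, ?_⟩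
    intro x hx y hy hxy
    simp only [Set.mem_Iio] at hx hy
    simp only [hx, hy, dif_pos] at hxy
    exact congrArg Subtype.val (e.injective hxy)
  choose h hinj using this
  have hmin : ∀ x y : T, ∃ ν, x < y → (GccBM h ν x y ∧ ∀ ν', GccBM h ν' x y → ν ≤ ν') := by
    intro x y
    by_cases hxy : x < y
    · have hne : {ν | GccBM h ν x y}.Nonempty := GccBM.cover hc hinj hreg hI y x hxy
      refine ⟨WellFounded.min (wellFounded_lt (α := W)) _ hne, fun _ => ⟨WellFounded.min_mem _ _ hne, fun ν' h' => ?_⟩⟩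
      exact not_lt.1 (WellFounded.not_lt_min (wellFounded_lt (α := W)) {ν | GccBM h ν x y} h')
    · exact ⟨hWne.some, fun h' => (hxy h').elim⟩
  choose ρ hρ using hmin
  have hiff : ∀ x y i, x < y → (ρ x y ≤ i ↔ GccBM h i x y) := fun x y i hxy =>
    ⟨fun hi => (hρ x y hxy).1.mono hi, fun hi => (hρ x y hxy).2 _ hi⟩
  have hg : ∀ i : W, ∃ f : T → W, ∀ x y, GccBM h i x y → f x < f y := by
    intro i
    refine gcc_rank c _ ?_ hreg (fun y => GccBM.small hc hinj hI i y)
    exact Subrelation.wf (fun H => GccBM.lt H) (wellFounded_lt (α := T))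
  choose g hg using hg
  refine ⟨ρ, fun x i => g i x, ?_, ?_⟩
  · intro x y z i hxy hyz h1 h2
    rw [hiff _ _ _ hxy]
    rw [hiff _ _ _ (hxy.trans hyz)] at h1
    rw [hiff _ _ _ hyz] at h2
    exact h1.coh h2 hxy
  · intro x y i hxy h1
    exact hg i x y ((hiff _ _ _ hxy).1 h1)
end

theorem gcc_Iio_reg (c : Cardinal.{0}) (hc : c.IsRegular) (s : Set (Set.Iio c.ord))
    (hs : #s < Cardinal.lift.{1} c) : ∃ b, ∀ x ∈ s, x < b := by
  have h1 : Order.cof (Set.Iio c.ord) = Cardinal.lift.{1} c := by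
    rw [Ordinal.cof_Iio, ← Ordinal.lift_cof, hc.cof_ord]
  have h2 : ¬ IsCofinal s := fun h => (not_lt_of_ge (Order.cof_le h)) (h1 ▸ hs)
  rwa [not_isCofinal_iff] at h2

theorem gcc_Iic_small (c : Cardinal.{0}) (hc : ℵ₀ ≤ c) (ν : Set.Iio c.ord) :
    #(Set.Iic ν) < Cardinal.lift.{1} c := by
  have h1 : Order.succ ν.1 < c.ord := (isSuccLimit_ord hc).succ_lt ν.2
  have h2 : #(Set.Iio (Order.succ ν.1)) < Cardinal.lift.{1} c := by
    rw [Cardinal.mk_Iio_ordinal, Cardinal.lift_lt]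
    exact lt_ord.1 h1
  refine lt_of_le_of_lt ?_ h2
  refine Cardinal.mk_le_of_injective
    (f := fun p : Set.Iic ν => (⟨p.1.1, Set.mem_Iio.2 (Order.lt_succ_iff.2 p.2)⟩ : Set.Iio (Order.succ ν.1))) ?_
  intro p q hpq
  have := congrArg Subtype.val hpq
  exact Subtype.ext (Subtype.ext this)

theorem gcc_lt_aleph_omega {c : Cardinal.{u}} (h : c < ℵ_ ω) : ∃ n : ℕ, c < ℵ_ n := by
  rw [aleph_limit isSuccLimit_omega0] at h
  obtain ⟨⟨a, ha⟩, h'⟩ := exists_lt_of_lt_ciSup' h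
  obtain ⟨n, rfl⟩ := lt_omega0.1 ha
  exact ⟨n, h'⟩

theorem gcc_lev {X : Type 1} (hX : #X = ℵ_ ω) :
    ∃ lev : X → ℕ, ∀ n : ℕ, #{x | lev x ≤ n} ≤ ℵ_ n := by
  have h0 : #X = #(Set.Iio (ℵ_ (ω : Ordinal.{0})).ord) := by
    rw [hX, Cardinal.mk_Iio_ordinal, card_ord, lift_aleph, lift_omega0]
  obtain ⟨e⟩ := Cardinal.eq.1 h0
  have hex : ∀ x : X, ∃ n : ℕ, (e x).1.card < ℵ_ n := fun x =>
    gcc_lt_aleph_omega (lt_ord.1 (e x).2)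
  choose lev hlev using hex
  refine ⟨lev, fun n => ?_⟩
  have h2 : #(Set.Iio (ℵ_ (n : Ordinal.{0})).ord) = ℵ_ n := by
    rw [Cardinal.mk_Iio_ordinal, card_ord, lift_aleph]
    simp
  rw [← h2]
  refine Cardinal.mk_le_of_injective (f := fun p : {x | lev x ≤ n} =>
    (⟨(e p.1).1, ?_⟩ : Set.Iio (ℵ_ (n : Ordinal.{0})).ord)) ?_
  · rw [Set.mem_Iio, lt_ord]
    refine (hlev p.1).trans_le (aleph_le_aleph.2 ?_)
    exact_mod_cast p.2
  · intro p q hpq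
    have := congrArg Subtype.val hpq
    exact Subtype.ext (e.injective (Subtype.ext this))

theorem gcc_pigeon {M : Type u} {D : Type u} [Countable D] (S : Set M) (hS : ¬ S.Countable)
    (f : M → D) : ∃ d, ¬ (S ∩ f ⁻¹' {d}).Countable := by
  by_contra! H
  apply hS
  have : S ⊆ ⋃ d, S ∩ f ⁻¹' {d} := fun x hx => Set.mem_iUnion.2 ⟨f x, hx, rfl⟩
  exact (Set.countable_iUnion H).mono this

theorem gcc_core {M X : Type 1} [LinearOrder M] [WellFoundedLT M] [LinearOrder X] [WellFoundedLT X]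
    (hM : #M = ℵ_ (ω + 1)) (hX : #X = ℵ_ ω) (ρ : M → M → X) (g : M → X → X)
    (hρ : ∀ x y z i, x < y → y < z → ρ x z ≤ i → ρ y z ≤ i → ρ x y ≤ i)
    (hg : ∀ x y i, x < y → ρ x y ≤ i → g x i < g y i) :
    ∃ f : ℕ → M → X, ∀ (S : Set M) (C : Set X), #S = ℵ_ 1 → C.Countable →
      (∀ x ∈ S, ∀ y ∈ S, ρ x y ∈ C) → (∀ n, ∀ x ∈ S, f n x ∈ C) → False := by
  classical
  have hXne : Nonempty X := by
    rw [← mk_ne_zero_iff, hX]; exact (aleph_pos _).ne'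
  obtain ⟨lev, hlev⟩ := gcc_lev hX
  obtain ⟨D, hDcof, hDcard⟩ := Order.exists_cof_eq X
  have hcofne : Order.cof X ≠ ℵ_ ω := by
    intro h
    have h1 := Order.cof_ord_cof X
    rw [h] at h1
    exact isSingular_aleph_omega0.cof_ord_lt.ne h1
  have hcoflt : #D < ℵ_ ω := by
    rw [hDcard]
    exact lt_of_le_of_ne ((Order.cof_le_cardinalMk (α := X)).trans hX.le) hcofne
  obtain ⟨m, hm⟩ := gcc_lt_aleph_omega hcoflt
  -- injectivity of g on the pieces
  have hpiece : ∀ (β : M) (i : X) (Q : Set X),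
      #{α | α < β ∧ ρ α β ≤ i ∧ g α i ∈ Q} ≤ #Q := by
    intro β i Q
    refine Cardinal.mk_le_of_injective
      (f := fun p : {α | α < β ∧ ρ α β ≤ i ∧ g α i ∈ Q} => (⟨g p.1 i, p.2.2.2⟩ : Q)) ?_
    intro p q hpq
    have hpq : g p.1 i = g q.1 i := congrArg Subtype.val hpq
    rcases lt_trichotomy p.1 q.1 with hlt | heq | hlt
    · exact absurd hpq (hg _ _ i hlt (hρ _ _ β i hlt q.2.1 p.2.2.1 q.2.2.1)).ne
    · exact Subtype.ext heq
    · exact absurd hpq (hg _ _ i hlt (hρ _ _ β i hlt p.2.1 q.2.2.1 p.2.2.1)).ne'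
  let R : ℕ → M → M → Prop := fun k α β => α < β ∧ ∃ i ∈ D, ρ α β ≤ i ∧ lev (g α i) ≤ k
  have hRsmall : ∀ k, m ≤ k → ∀ β, #{α | R k α β} < ℵ_ ((k : Ordinal.{1}) + 1) := by
    intro k hk β
    have hreg := isRegular_aleph_add_one (k : Ordinal.{1})
    have hlt : ℵ_ (k : Ordinal.{1}) < ℵ_ ((k : Ordinal.{1}) + 1) :=
      aleph_lt_aleph.2 (lt_add_one _)
    have hsub : {α | R k α β} ⊆
        ⋃ i ∈ D, {α | α < β ∧ ρ α β ≤ i ∧ g α i ∈ {x | lev x ≤ k}} := by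
      rintro α ⟨h1, i, hi, h2, h3⟩
      simp only [Set.mem_iUnion]
      exact ⟨i, hi, h1, h2, h3⟩
    refine (mk_le_mk_of_subset hsub).trans_lt ?_
    rw [card_biUnion_lt_iff_forall_of_isRegular hreg]
    · intro i _
      exact ((hpiece β i _).trans (hlev k)).trans_lt hlt
    · refine hm.trans_le ((aleph_le_aleph.2 ?_).trans hlt.le)
      exact_mod_cast hk
  have hf : ∀ k, ∃ f : M → X, m ≤ k → ∀ α β, R k α β → f α ≠ f β := by
    intro k
    by_cases hk : m ≤ k
    swap
    · exact ⟨fun _ => hXne.some, fun h => (hk h).elim⟩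
    have hreg0 := isRegular_aleph_add_one (k : Ordinal.{0})
    have hlift : Cardinal.lift.{1} (ℵ_ ((k : Ordinal.{0}) + 1)) = ℵ_ ((k : Ordinal.{1}) + 1) := by
      rw [lift_aleph]; simp
    obtain ⟨f, hf⟩ := gcc_rank (W := Set.Iio (ℵ_ ((k : Ordinal.{0}) + 1)).ord)
      (ℵ_ ((k : Ordinal.{1}) + 1)) (R k)
      (Subrelation.wf (fun H => H.1) (wellFounded_lt (α := M)))
      (fun s hs => gcc_Iio_reg _ hreg0 s (by rwa [hlift])) (hRsmall k hk)
    have hle : #(Set.Iio (ℵ_ ((k : Ordinal.{0}) + 1)).ord) ≤ #X := by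
      rw [Cardinal.mk_Iio_ordinal, card_ord, hlift, hX, aleph_le_aleph]
      exact_mod_cast (natCast_lt_omega0 (k + 1)).le
    obtain ⟨e⟩ := Cardinal.le_def _ _ |>.1 hle
    exact ⟨fun x => e (f x), fun _ α β h heq => (hf α β h).ne (e.injective heq)⟩
  choose f hf using hf
  refine ⟨f, fun S C hS hC hSρ hSf => ?_⟩
  have hSunc : ¬ S.Countable := by
    intro h
    rw [← le_aleph0_iff_set_countable, hS] at h
    exact absurd h (not_le_of_gt aleph0_lt_aleph_one)
  obtain ⟨i, hiD, S', hS'S, hS'unc, hS'⟩ : ∃ i ∈ D, ∃ S' ⊆ S, ¬ S'.Countable ∧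
      ∀ x ∈ S', ∀ y ∈ S', x < y → ρ x y ≤ i := by
    by_cases hcof : D.Countable
    · -- bounded
      have hb : ∃ γ, ∀ α ∈ S, α < γ := by
        by_contra! H
        have hreg := isRegular_aleph_add_one (ω : Ordinal.{1})
        have hlt : ℵ_ (ω : Ordinal.{1}) < ℵ_ ((ω : Ordinal.{1}) + 1) :=
          aleph_lt_aleph.2 (lt_add_one _)
        have hIio : ∀ β : M, #(Set.Iio β) < ℵ_ ((ω : Ordinal.{1}) + 1) := by
          intro β
          have hsub : Set.Iio β ⊆ ⋃ i : X, {α | α < β ∧ ρ α β ≤ i ∧ g α i ∈ Set.univ} := by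
            intro α hα
            simp only [Set.mem_iUnion]
            exact ⟨ρ α β, hα, le_rfl, trivial⟩
          refine (mk_le_mk_of_subset hsub).trans_lt ?_
          rw [card_iUnion_lt_iff_forall_of_isRegular hreg (hX ▸ hlt)]
          intro i
          refine (hpiece β i _).trans_lt ?_
          rw [mk_univ, hX]
          exact hlt
        have hsub : (Set.univ : Set M) ⊆ ⋃ β ∈ S, insert β (Set.Iio β) := by
          intro γ _
          obtain ⟨α, hα, hγ⟩ := H γ
          simp only [Set.mem_iUnion]
          exact ⟨α, hα, hγ.eq_or_lt⟩
        have h1 := mk_le_mk_of_subset hsub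
        rw [mk_univ, hM] at h1
        refine absurd h1 (not_le_of_gt ?_)
        rw [card_biUnion_lt_iff_forall_of_isRegular hreg]
        · intro a _
          exact mk_insert_le.trans_lt (Cardinal.add_lt_of_lt hreg.aleph0_le (hIio a)
            (lt_of_lt_of_le one_lt_aleph0 hreg.aleph0_le))
        · rw [hS, aleph_lt_aleph]
          exact lt_of_lt_of_le one_lt_omega0 (le_self_add)
      obtain ⟨γ, hγ⟩ := hb
      have : ∀ α : M, ∃ d : D, ρ α γ ≤ d := by
        intro α
        obtain ⟨d, hd, h⟩ := hDcof (ρ α γ)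
        exact ⟨⟨d, hd⟩, h⟩
      choose d hd using this
      have : Countable D := hcof
      obtain ⟨i, hi⟩ := gcc_pigeon S hSunc d
      refine ⟨i.1, i.2, _, Set.inter_subset_left, hi, ?_⟩
      rintro x ⟨hx, hxi⟩ y ⟨hy, hyi⟩ hxy
      have hxi : d x = i := hxi
      have hyi : d y = i := hyi
      exact hρ x y γ i hxy (hγ y hy) (hxi ▸ hd x) (hyi ▸ hd y)
    · have hnc : ¬ IsCofinal C := by
        intro h
        have h1 := Order.cof_le h
        rw [← hDcard] at h1
        apply hcof
        rw [← le_aleph0_iff_set_countable] at hC ⊢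
        exact h1.trans hC
      rw [not_isCofinal_iff] at hnc
      obtain ⟨b, hb⟩ := hnc
      obtain ⟨i, hi, hbi⟩ := hDcof b
      exact ⟨i, hi, S, subset_rfl, hSunc, fun x hx y hy _ => (hb _ (hSρ x hx y hy)).le.trans hbi⟩
  obtain ⟨⟨n⟩, hn⟩ := gcc_pigeon S' hS'unc (fun α => ULift.up.{1} (lev (g α i)))
  apply hn
  have hmaps : Set.MapsTo (f (max n m)) (S' ∩ (fun α => ULift.up.{1} (lev (g α i))) ⁻¹' {⟨n⟩}) C :=
    fun x hx => hSf _ x (hS'S hx.1)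
  refine hmaps.countable_of_injOn ?_ hC
  have hR : ∀ x ∈ S', ∀ y ∈ S', ULift.up.{1} (lev (g x i)) = ⟨n⟩ → x < y → R (max n m) x y := by
    intro x hx y hy hxn hxy
    refine ⟨hxy, i, hiD, hS' x hx y hy hxy, ?_⟩
    have : lev (g x i) = n := congrArg ULift.down hxn
    rw [this]
    exact le_max_left _ _
  rintro x ⟨hx, hxn⟩ y ⟨hy, hyn⟩ hxy
  rcases lt_trichotomy x y with hlt | heq | hlt
  · exact absurd hxy (hf _ (le_max_right _ _) _ _ (hR x hx y hy hxn hlt))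
  · exact heq
  · exact absurd hxy.symm (hf _ (le_max_right _ _) _ _ (hR y hy x hx hyn hlt))

theorem gcc_closed {k1 k0 m1 m0 : Cardinal.{0}} (h : ChangCC k1 k0 m1 m0)
    (F : ℕ → Set.Iio k1.ord → Set.Iio k1.ord → Set.Iio k1.ord) :
    ∃ B : Set (Set.Iio k1.ord), (∀ n, ∀ x ∈ B, ∀ y ∈ B, F n x y ∈ B) ∧
      #B = Cardinal.lift.{1,0} m1 ∧
      #{x : Set.Iio k1.ord // x ∈ B ∧ x.val < k0.ord} = Cardinal.lift.{1,0} m0 := by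
  let L : FirstOrder.Language.{0,0} := ⟨fun n => {_p : ℕ // n = 2}, fun _ => Empty⟩
  have hL : Countable L.Symbols := by
    have h1 : Countable (Σ l, L.Functions l) := by
      change Countable (Σ n : ℕ, {_p : ℕ // n = 2})
      infer_instance
    have h2 : Countable (Σ l, L.Relations l) := by
      change Countable (Σ n : ℕ, Empty)
      infer_instance
    change Countable ((Σ l, L.Functions l) ⊕ (Σ l, L.Relations l))
    infer_instance
  let str : L.Structure (Set.Iio k1.ord) :=
    { funMap := fun {n} f x => F f.1 (x ⟨0, by have := f.2; omega⟩) (x ⟨1, by have := f.2; omega⟩)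
      RelMap := fun {n} r => r.elim }
  obtain ⟨B, h1, h2⟩ := h L hL str
  refine ⟨B, ?_, h1, h2⟩
  intro n x hx y hy
  have := B.fun_mem (n := 2) (⟨n, rfl⟩ : {_p : ℕ // 2 = 2}) ![x, y] (by
    intro i
    fin_cases i
    · exact hx
    · exact hy)
  exact this

theorem gcc_main (h1 : ChangCC (ℵ_ (ω + 2)) (ℵ_ (ω + 1)) (ℵ_ (ω + 1)) (ℵ_ ω))
    (h2 : ChangCC (ℵ_ (ω + 1)) (ℵ_ ω) (ℵ_ 1) (ℵ_ 0)) : False := by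
  classical
  have hlift : Cardinal.lift.{1} (ℵ_ ((ω : Ordinal.{0}) + 1)) = ℵ_ (ω + 1) := by
    rw [lift_aleph]; simp
  have hliftω : Cardinal.lift.{1} (ℵ_ (ω : Ordinal.{0})) = ℵ_ ω := by
    rw [lift_aleph]; simp
  have hreg0 := isRegular_aleph_add_one (ω : Ordinal.{0})
  have h12 : ((ω : Ordinal.{0}) + 2) = ω + 1 + 1 := by
    rw [add_assoc, one_add_one_eq_two]
  have hordle : (ℵ_ ((ω : Ordinal.{0}) + 1)).ord ≤ (ℵ_ ((ω : Ordinal.{0}) + 2)).ord := by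
    rw [ord_le_ord, aleph_le_aleph, h12]
    exact le_self_add
  obtain ⟨ρ, g, hρ, hg⟩ := gcc_rho (T := Set.Iio (ℵ_ ((ω : Ordinal.{0}) + 2)).ord)
    (W := Set.Iio (ℵ_ ((ω : Ordinal.{0}) + 1)).ord) hreg0.lift
    (by rw [Cardinal.mk_Iio_ordinal, card_ord])
    (by
      intro β
      have := gcc_Iic_small (ℵ_ ((ω : Ordinal.{0}) + 2)) (aleph0_le_aleph _) β
      have hs : ℵ_ ((ω : Ordinal.{0}) + 2) = Order.succ (ℵ_ ((ω : Ordinal.{0}) + 1)) := by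
        rw [h12, succ_aleph]
      have h3 : Cardinal.lift.{1} (ℵ_ ((ω : Ordinal.{0}) + 2)) =
          Order.succ (Cardinal.lift.{1} (ℵ_ ((ω : Ordinal.{0}) + 1))) := by
        rw [hs, Cardinal.lift_succ]
      refine le_trans (mk_le_mk_of_subset ?_) (Order.lt_succ_iff.1 (this.trans_eq h3))
      exact Set.Iio_subset_Iic_self)
    (fun s hs => gcc_Iio_reg _ hreg0 s hs)
    (fun ν => gcc_Iic_small _ hreg0.aleph0_le ν)
  let inc : Set.Iio (ℵ_ ((ω : Ordinal.{0}) + 1)).ord → Set.Iio (ℵ_ ((ω : Ordinal.{0}) + 2)).ord :=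
    fun x => ⟨x.1, lt_of_lt_of_le x.2 hordle⟩
  obtain ⟨M, hMc, hM, hMX⟩ := gcc_closed h1 (fun n α x =>
    if n = 0 then inc (ρ α x) else
      if hx : x.1 < (ℵ_ ((ω : Ordinal.{0}) + 1)).ord then inc (g α ⟨x.1, hx⟩) else x)
  let X : Set (Set.Iio (ℵ_ ((ω : Ordinal.{0}) + 1)).ord) := {x | inc x ∈ M}
  have hX : #X = ℵ_ ω := by
    rw [← hliftω, ← hMX]
    refine Cardinal.mk_congr ⟨fun x => ⟨inc x.1, x.2, x.1.2⟩, fun x => ⟨⟨x.1.1, x.2.2⟩, x.2.1⟩, ?_, ?_⟩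
    · intro x; rfl
    · intro x; rfl
  have hMρ : ∀ x ∈ M, ∀ y ∈ M, ρ x y ∈ X := by
    intro x hx y hy
    have := hMc 0 x hx y hy
    rw [if_pos rfl] at this
    exact this
  have hMg : ∀ x ∈ M, ∀ y ∈ X, g x y ∈ X := by
    intro x hx y hy
    have := hMc 1 x hx _ hy
    have hy' : (inc y).1 < (ℵ_ ((ω : Ordinal.{0}) + 1)).ord := y.2
    rw [if_neg one_ne_zero, dif_pos hy'] at this
    exact this
  rw [hlift] at hM
  obtain ⟨f, hf⟩ := gcc_core (M := M) (X := X) hM hX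
    (fun x y => ⟨ρ x.1 y.1, hMρ _ x.2 _ y.2⟩) (fun x y => ⟨g x.1 y.1, hMg _ x.2 _ y.2⟩)
    (fun x y z i h1 h2 h3 h4 => hρ x.1 y.1 z.1 i.1 h1 h2 h3 h4)
    (fun x y i h1 h2 => hg x.1 y.1 i.1 h1 h2)
  have he : #(Set.Iio (ℵ_ ((ω : Ordinal.{0}) + 1)).ord) = #M := by
    rw [Cardinal.mk_Iio_ordinal, card_ord, hM, hlift]
  obtain ⟨e⟩ := Cardinal.eq.1 he
  have he' : #X = #(Set.Iio (ℵ_ (ω : Ordinal.{0})).ord) := by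
    rw [Cardinal.mk_Iio_ordinal, card_ord, hX, hliftω]
  obtain ⟨e'⟩ := Cardinal.eq.1 he'
  have hordle' : (ℵ_ (ω : Ordinal.{0})).ord ≤ (ℵ_ ((ω : Ordinal.{0}) + 1)).ord := by
    rw [ord_le_ord, aleph_le_aleph]
    exact le_self_add
  let k : X → Set.Iio (ℵ_ ((ω : Ordinal.{0}) + 1)).ord :=
    fun x => ⟨(e' x).1, lt_of_lt_of_le (e' x).2 hordle'⟩
  obtain ⟨B, hBc, hB, hB0⟩ := gcc_closed h2 (fun n a b =>
    if n = 0 then k ⟨ρ (e a).1 (e b).1, hMρ _ (e a).2 _ (e b).2⟩ else k (f (n - 1) (e a)))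
  refine hf (e '' B) {x | k x ∈ B} ?_ ?_ ?_ ?_
  · rw [mk_image_eq e.injective, hB, lift_aleph]; simp
  · rw [← le_aleph0_iff_set_countable]
    have : Cardinal.lift.{1} (ℵ_ (0 : Ordinal.{0})) = ℵ₀ := by simp
    rw [← this, ← hB0]
    refine Cardinal.mk_le_of_injective (f := fun p : {x | k x ∈ B} => ⟨k p.1, p.2, (e' p.1).2⟩) ?_
    intro p q hpq
    have := congrArg (fun z => z.1.1) hpq
    exact Subtype.ext (e'.injective (Subtype.ext this))
  · rintro _ ⟨a, ha, rfl⟩ _ ⟨b, hb, rfl⟩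
    simpa using hBc 0 a ha b hb
  · rintro n _ ⟨a, ha, rfl⟩
    simpa using hBc (n + 1) a ha a ha

theorem no_initial_gcc_beyond_aleph_omega :
    ¬ (ChangCC (Cardinal.aleph (Ordinal.omega0 + 2)) (Cardinal.aleph (Ordinal.omega0 + 1))
          (Cardinal.aleph (Ordinal.omega0 + 1)) (Cardinal.aleph Ordinal.omega0) ∧
       ChangCC (Cardinal.aleph (Ordinal.omega0 + 1)) (Cardinal.aleph Ordinal.omega0)
          (Cardinal.aleph 1) (Cardinal.aleph 0)) ∧
    ¬ (∀ μ κ : Cardinal.{0}, ℵ₀ ≤ μ → μ < κ → κ ≤ Cardinal.aleph (Ordinal.omega0 + 1) →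
        μ.ord.cof ≤ κ.ord.cof → ChangCC (Order.succ κ) κ (Order.succ μ) μ) := by
  have key : ¬ (ChangCC (Cardinal.aleph (Ordinal.omega0 + 2)) (Cardinal.aleph (Ordinal.omega0 + 1))
          (Cardinal.aleph (Ordinal.omega0 + 1)) (Cardinal.aleph Ordinal.omega0) ∧
       ChangCC (Cardinal.aleph (Ordinal.omega0 + 1)) (Cardinal.aleph Ordinal.omega0)
          (Cardinal.aleph 1) (Cardinal.aleph 0)) := fun h => gcc_main h.1 h.2
  refine ⟨key, fun H => key ⟨?_, ?_⟩⟩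
  · have h12 : ((ω : Ordinal.{0}) + 2) = ω + 1 + 1 := by
      rw [add_assoc, one_add_one_eq_two]
    have h := H (ℵ_ ω) (ℵ_ (ω + 1)) (aleph0_le_aleph _) (aleph_lt_aleph.2 (lt_add_one _)) le_rfl ?_
    · rw [succ_aleph, succ_aleph, ← h12] at h
      exact h
    · rw [(isRegular_aleph_add_one ω).cof_ord]
      exact (cof_ord_le _).trans (aleph_le_aleph.2 le_self_add)
  · have h := H (ℵ_ 0) (ℵ_ ω) (aleph0_le_aleph _) (aleph_lt_aleph.2 omega0_pos)
      (aleph_le_aleph.2 le_self_add) ?_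
    · rw [succ_aleph, succ_aleph, zero_add] at h
      exact h
    · rw [ord_aleph, ord_aleph, cof_omega isSuccLimit_omega0]
      simp
end

section
/- Suppose κ is a singular cardinal and ⟨f_α : α < κ⁺⟩ is a scale for κ in a product ∏_{i<cf(κ)} κ_i. Then there is a club C ⊆ κ⁺ such that for all regular cardinals μ and ν satisfying cf(κ) < μ, μ^{+3} ≤ ν, ν < μ^{+cf(κ)}, and μ^{+cf(κ)} ≤ κ, the scale ⟨f_α : α < κ⁺⟩ is good at every α ∈ C with cf(α) = ν. -/
open Cardinal Ordinal

/-- The `ν`-th iterated cardinal successor of `μ`: if `μ = ℵ_α` then `iterSucc μ ν = ℵ_{α+ν}`. -/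
noncomputable def iterSucc (μ : Cardinal.{0}) (ν : Ordinal.{0}) : Cardinal.{0} :=
  Cardinal.preAleph (Cardinal.preAleph.symm μ + ν)

/-- `f < g` in the ordering modulo sets of size `< cf(κ)`:
`|{i < cf(κ) : f(i) ≥ g(i)}| < cf(κ)`.  (Indices range over ordinals below the initial
ordinal of `cf(κ) = κ.ord.cof`.) -/
def ptLT (κ : Cardinal.{0}) (f g : Ordinal → Ordinal) : Prop :=
  #{i : Ordinal | i < κ.ord.cof.ord ∧ g i ≤ f i} < Cardinal.lift.{1,0} κ.ord.cof

/-- `h` is a member of the product `∏_{i < cf(κ)} κs i`. -/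
def ProdMem (κ : Cardinal.{0}) (κs : Ordinal.{0} → Cardinal.{0}) (h : Ordinal → Ordinal) : Prop :=
  ∀ i < κ.ord.cof.ord, h i < (κs i).ord

/-- `(κs, f)` is a scale for the singular cardinal `κ`: `⟨κs i : i < cf(κ)⟩` is an increasing
sequence of regular cardinals cofinal in `κ`, and `⟨f α : α < κ⁺⟩` is increasing and cofinal
in `∏_{i<cf(κ)} κs i` with respect to `ptLT`. -/
def IsScale (κ : Cardinal.{0}) (κs : Ordinal.{0} → Cardinal.{0})
    (f : Ordinal → Ordinal → Ordinal) : Prop :=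
  (∀ i, i < κ.ord.cof.ord → (κs i).IsRegular ∧ κs i < κ) ∧
  (∀ i j, i < j → j < κ.ord.cof.ord → κs i < κs j) ∧
  (∀ c < κ, ∃ i < κ.ord.cof.ord, c < κs i) ∧
  (∀ α < (Order.succ κ).ord, ProdMem κ κs (f α)) ∧
  (∀ α β, α < β → β < (Order.succ κ).ord → ptLT κ (f α) (f β)) ∧
  (∀ h, ProdMem κ κs h → ∃ α < (Order.succ κ).ord, ptLT κ h (f α))

/-- The scale `(κs, f)` is good at `α`: there are `⟨g ζ : ζ < cf(α)⟩` in the product and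
`j* < cf(κ)` such that `⟨g ζ j : ζ < cf(α)⟩` is strictly increasing for all `j* ≤ j < cf(κ)`,
and `⟨g ζ⟩` and `⟨f β : β < α⟩` are mutually cofinal. -/
def GoodAt (κ : Cardinal.{0}) (κs : Ordinal.{0} → Cardinal.{0})
    (f : Ordinal → Ordinal → Ordinal) (α : Ordinal) : Prop :=
  ∃ (g : Ordinal → Ordinal → Ordinal) (j' : Ordinal), j' < κ.ord.cof.ord ∧
    (∀ ζ < α.cof.ord, ProdMem κ κs (g ζ)) ∧
    (∀ j, j' ≤ j → j < κ.ord.cof.ord → ∀ ζ ζ', ζ < ζ' → ζ' < α.cof.ord → g ζ j < g ζ' j) ∧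
    (∀ ζ < α.cof.ord, ∃ β < α, ptLT κ (g ζ) (f β)) ∧
    (∀ β < α, ∃ ζ < α.cof.ord, ptLT κ (f β) (g ζ))

/-- `C` is a club (closed unbounded) subset of `α`: `C ⊆ α`, `C` contains each of its limit
points below `α`, and `C` is unbounded in `α`. -/
def IsClubIn (C : Set Ordinal.{0}) (α : Ordinal.{0}) : Prop :=
  C ⊆ Set.Iio α ∧
  (∀ β < α, 0 < β → sSup (C ∩ Set.Iio β) = β → β ∈ C) ∧
  (∀ γ < α, ∃ δ ∈ C, γ ≤ δ)


theorem bddSet {s : Set Ordinal.{0}} {a : Ordinal.{0}} (hs : #s < Cardinal.lift.{1} a.cof)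
    (h : ∀ i ∈ s, i < a) : ∃ b < a, ∀ i ∈ s, i < b := by
  refine ⟨sSup ((· + 1) '' s), sSup_add_one_lt_of_lt_cof (by rwa [← lift_cof]) h, ?_⟩
  intro i hi
  have hb : BddAbove ((· + 1) '' s) := by
    refine ⟨a, ?_⟩
    rintro _ ⟨x, hx, rfl⟩
    simpa using Order.succ_le_of_lt (h x hx)
  exact (lt_add_one i).trans_le (le_csSup hb ⟨i, hi, rfl⟩)

theorem bddFam {I : Type} {a : Ordinal.{0}} (hs : #I < a.cof) {f : I → Ordinal.{0}}
    (h : ∀ i, f i < a) : ∃ b < a, ∀ i, f i < b := by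
  obtain ⟨b, hb, hb'⟩ := bddSet (s := Set.range f) (a := a) (by
    have := mk_range_le_lift (f := f)
    simp only [Cardinal.lift_id'.{0,1}] at this
    exact this.trans_lt (Cardinal.lift_lt.2 hs)) (by rintro _ ⟨i, rfl⟩; exact h i)
  exact ⟨b, hb, fun i => hb' _ ⟨i, rfl⟩⟩

theorem bddIio {o a : Ordinal.{0}} (hs : o.card < a.cof) {f : Ordinal.{0} → Ordinal.{0}}
    (h : ∀ i < o, f i < a) : ∃ b < a, ∀ i < o, f i < b := by
  obtain ⟨b, hb, hb'⟩ := bddSet (s := f '' Set.Iio o) (a := a) (by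
    refine mk_image_le.trans_lt ?_
    rw [Cardinal.mk_Iio_ordinal]
    exact Cardinal.lift_lt.2 hs) (by rintro _ ⟨i, hi, rfl⟩; exact h i hi)
  exact ⟨b, hb, fun i hi => hb' _ ⟨i, hi, rfl⟩⟩

theorem exCof (δ : Ordinal.{0}) : ∃ E : Set Ordinal.{0}, (∀ e ∈ E, e < δ) ∧
    #E ≤ Cardinal.lift.{1} δ.cof ∧ ∀ t < δ, ∃ e ∈ E, t ≤ e := by
  obtain ⟨s, hs, hs'⟩ := Order.exists_cof_eq (Set.Iio δ)
  refine ⟨Subtype.val '' s, ?_, ?_, ?_⟩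
  · rintro _ ⟨x, _, rfl⟩; exact x.2
  · refine mk_image_le.trans ?_
    rw [hs', cof_Iio, lift_cof]
  · intro t ht
    obtain ⟨b, hb, hb'⟩ := hs ⟨t, ht⟩
    exact ⟨b, ⟨b, hb, rfl⟩, hb'⟩

theorem exFund (δ : Ordinal.{0}) : ∃ e : Ordinal.{0} → Ordinal.{0},
    (∀ i j, i < j → j < δ.cof.ord → e i < e j) ∧ (∀ i < δ.cof.ord, e i < δ) ∧
    ∀ t < δ, ∃ i < δ.cof.ord, t ≤ e i := by
  classical
  obtain ⟨f, hf⟩ := exists_isFundamentalSeq (o := δ) rfl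
  refine ⟨fun i => if h : i < δ.cof.ord then (f ⟨i, h⟩).1 else 0, ?_, ?_, ?_⟩
  · intro i j hij hj
    simp only [hj, hij.trans hj, dif_pos]
    exact hf.strictMono hij
  · intro i hi
    simp only [hi, dif_pos]
    exact (f _).2
  · intro t ht
    obtain ⟨b, ⟨i, rfl⟩, hb'⟩ := hf.isCofinal_range ⟨t, ht⟩
    refine ⟨i, i.2, ?_⟩
    have := i.2
    simp only [Set.mem_Iio] at this
    simp only [this, dif_pos]
    exact hb'

theorem iterLem {δ : Ordinal.{0}} (hδ : ℵ₀ < δ.cof) (m : Ordinal.{0} → Ordinal.{0})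
    (hm : ∀ y < δ, y < m y ∧ m y < δ) {x : Ordinal.{0}} (hx : x < δ) :
    ∃ β < δ, x < β ∧ ∀ t < β, ∃ y, t < y ∧ y < β ∧ m y < β := by
  have h1 : ∀ n : ℕ, m^[n] x < δ := by
    intro n
    induction n with
    | zero => exact hx
    | succ n ih => rw [Function.iterate_succ_apply']; exact (hm _ ih).2
  have h2 : ∀ n : ℕ, m^[n] x < m^[n+1] x := by
    intro n
    rw [Function.iterate_succ_apply']; exact (hm _ (h1 n)).1
  have h3 : ∀ n : ℕ, m^[n] x < ⨆ n : ℕ, m^[n] x := fun n =>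
    (h2 n).trans_le (Ordinal.le_iSup (fun n : ℕ => m^[n] x) (n+1))
  refine ⟨⨆ n : ℕ, m^[n] x, iSup_lt_of_lt_cof (by simpa using hδ) h1, h3 0, ?_⟩
  intro t ht
  rw [Ordinal.lt_iSup_iff] at ht
  obtain ⟨n, hn⟩ := ht
  refine ⟨m^[n] x, hn, h3 n, ?_⟩
  have := h3 (n+1)
  rwa [Function.iterate_succ_apply'] at this

/-- own notion of club -/
def Clb (D : Set Ordinal.{0}) (δ : Ordinal.{0}) : Prop :=
  (∀ β < δ, 0 < β → (∀ x < β, ∃ y ∈ D, x < y ∧ y < β) → β ∈ D) ∧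
  (∀ x < δ, ∃ y ∈ D, x < y ∧ y < δ)

/-- limit points -/
def limPts (E : Set Ordinal.{0}) : Set Ordinal.{0} := {s | ∀ t < s, ∃ e ∈ E, t < e ∧ e < s}

theorem Clb.inter {δ : Ordinal.{0}} (hδ : ℵ₀ < δ.cof) {T : Set Ordinal.{0}}
    (hT : #T < Cardinal.lift.{1} δ.cof) {D : Ordinal.{0} → Set Ordinal.{0}}
    (hD : ∀ i ∈ T, Clb (D i) δ) : Clb {x | ∀ i ∈ T, x ∈ D i} δ := by
  classical
  have hlim : Order.IsSuccLimit δ := one_lt_cof_iff.1 (one_lt_aleph0.trans hδ)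
  constructor
  · intro β hβ h0 h i hi
    refine (hD i hi).1 β hβ h0 ?_
    intro x hx
    obtain ⟨y, hy, h⟩ := h x hx
    exact ⟨y, hy i hi, h⟩
  · intro x hx
    have h1 : ∀ y < δ, ∃ z, z < δ ∧ y < z ∧ ∀ i ∈ T, ∃ w ∈ D i, y < w ∧ w < z := by
      intro y hy
      have : ∀ i, ∃ w, w < δ ∧ (i ∈ T → w ∈ D i ∧ y < w) := by
        intro i
        by_cases hi : i ∈ T
        · obtain ⟨w, hw, h1, h2⟩ := (hD i hi).2 y hy
          exact ⟨w, h2, fun _ => ⟨hw, h1⟩⟩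
        · exact ⟨y, hy, fun h => absurd h hi⟩
      choose w hw using this
      obtain ⟨b, hb, hb'⟩ := bddSet (s := w '' T) (a := δ) (mk_image_le.trans_lt hT)
        (by rintro _ ⟨i, _, rfl⟩; exact (hw i).1)
      refine ⟨max b (y+1), max_lt hb (hlim.succ_lt hy), lt_max_of_lt_right (lt_add_one y), ?_⟩
      intro i hi
      exact ⟨w i, ((hw i).2 hi).1, ((hw i).2 hi).2, lt_max_of_lt_left (hb' _ ⟨i, hi, rfl⟩)⟩
    choose! m hm using h1
    obtain ⟨β, hβ, hxβ, h⟩ := iterLem hδ m (fun y hy => ⟨(hm y hy).2.1, (hm y hy).1⟩) hx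
    refine ⟨β, ?_, hxβ, hβ⟩
    intro i hi
    refine (hD i hi).1 β hβ (by exact bot_le.trans_lt hxβ) ?_
    intro t ht
    obtain ⟨y, h1, h2, h3⟩ := h t ht
    obtain ⟨w, hw, h4, h5⟩ := (hm y (h2.trans hβ)).2.2 i hi
    exact ⟨w, hw, h1.trans h4, h5.trans h3⟩

theorem clb_limPts {E : Set Ordinal.{0}} {δ : Ordinal.{0}} (hδ : ℵ₀ < δ.cof)
    (hE : ∀ e ∈ E, e < δ) (hE' : ∀ t < δ, ∃ e ∈ E, t ≤ e) : Clb (limPts E) δ := by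
  have hlim : Order.IsSuccLimit δ := one_lt_cof_iff.1 (one_lt_aleph0.trans hδ)
  constructor
  · intro β hβ h0 h t ht
    obtain ⟨y, hy, h1, h2⟩ := h t ht
    obtain ⟨e, he, h3, h4⟩ := hy t h1
    exact ⟨e, he, h3, h4.trans h2⟩
  · intro x hx
    have h1 : ∀ y < δ, ∃ z ∈ E, y < z := by
      intro y hy
      obtain ⟨e, he, h⟩ := hE' (y+1) (hlim.succ_lt hy)
      exact ⟨e, he, (lt_add_one y).trans_le h⟩
    choose! m hm using h1
    obtain ⟨β, hβ, hxβ, h⟩ := iterLem hδ m (fun y hy => ⟨(hm y hy).2, hE _ (hm y hy).1⟩) hx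
    refine ⟨β, ?_, hxβ, hβ⟩
    intro t ht
    obtain ⟨y, h1, h2, h3⟩ := h t ht
    exact ⟨m y, (hm y (h2.trans hβ)).1, h1.trans (hm y (h2.trans hβ)).2, h3⟩

theorem mk_limPts_le {E : Set Ordinal.{0}} {δ : Ordinal.{0}}
    (hE' : ∀ t < δ, ∃ e ∈ E, t ≤ e) : #(limPts E ∩ Set.Iio δ : Set Ordinal.{0}) ≤ #E := by
  have : ∀ s : (limPts E ∩ Set.Iio δ : Set Ordinal.{0}), (E ∩ Set.Ici s.1).Nonempty := by
    intro s
    obtain ⟨e, he, h⟩ := hE' s s.2.2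
    exact ⟨e, he, h⟩
  refine mk_le_of_injective (f := fun s => (⟨sInf (E ∩ Set.Ici s.1), (csInf_mem (this s)).1⟩ : E)) ?_
  have key : ∀ s s' : (limPts E ∩ Set.Iio δ : Set Ordinal.{0}), s.1 < s'.1 →
      sInf (E ∩ Set.Ici s.1) < sInf (E ∩ Set.Ici s'.1) := by
    intro s s' h
    obtain ⟨e, he, h1, h2⟩ := s'.2.1 s h
    exact (csInf_le' (show e ∈ E ∩ Set.Ici s.1 from ⟨he, h1.le⟩)).trans_lt (h2.trans_le (csInf_mem (this s')).2)
  intro s s' h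
  simp only [Subtype.mk.injEq] at h
  rcases lt_trichotomy s.1 s'.1 with h1 | h1 | h1
  · exact absurd h (key _ _ h1).ne
  · exact Subtype.ext h1
  · exact absurd h (key _ _ h1).ne'

theorem recLem (G : (Ordinal.{0} → Ordinal.{0}) → Ordinal.{0} → Ordinal.{0})
    (hG : ∀ ξ ξ' j, (∀ k ≤ j, ξ k = ξ' k) → G ξ j = G ξ' j) :
    ∃ ξ : Ordinal.{0} → Ordinal.{0}, ∀ i, ξ i = sSup (G ξ '' Set.Iio i) := by
  classical
  let F : (i : Ordinal.{0}) → ((j : Ordinal.{0}) → j < i → Ordinal.{0}) → Ordinal.{0} :=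
    fun i r => sSup (G (fun k => if h : k < i then r k h else 0) '' Set.Iio i)
  refine ⟨WellFounded.fix (C := fun _ => Ordinal.{0}) (wellFounded_lt (α := Ordinal.{0})) F, ?_⟩
  intro i
  rw [WellFounded.fix_eq]
  change sSup _ = sSup _
  congr 1
  refine Set.image_congr ?_
  intro j hj
  refine hG _ _ _ ?_
  intro k hk
  have : k < i := hk.trans_lt hj
  simp [this]


theorem recLem2 (G : (Ordinal.{0} → Ordinal.{0}) → Ordinal.{0} → Ordinal.{0})
    (hG : ∀ ξ ξ' j, (∀ k ≤ j, ξ k = ξ' k) → G ξ j = G ξ' j)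
    (hgt : ∀ ξ j, ξ j < G ξ j) :
    ∃ ξ : Ordinal.{0} → Ordinal.{0}, Order.IsNormal ξ ∧ (∀ i j, j < i → G ξ j ≤ ξ i) ∧
      ∀ i b, (∀ j < i, G ξ j ≤ b) → ξ i ≤ b := by
  obtain ⟨ξ, hξ⟩ := recLem G hG
  have h1 : ∀ i j, j < i → G ξ j ≤ ξ i := by
    intro i j hj
    rw [hξ i]
    exact le_csSup bddAbove_of_small ⟨j, hj, rfl⟩
  have h2 : ∀ i b, (∀ j < i, G ξ j ≤ b) → ξ i ≤ b := by
    intro i b h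
    rw [hξ i]
    refine csSup_le' ?_
    rintro _ ⟨j, hj, rfl⟩
    exact h j hj
  refine ⟨ξ, ?_, h1, h2⟩
  rw [Order.isNormal_iff]
  refine ⟨fun j i hij => (hgt ξ j).trans_le (h1 i j hij), ?_⟩
  intro o ho a ha
  refine h2 o a fun j hj => ?_
  exact (h1 _ j (Order.lt_succ j)).trans (ha _ (ho.succ_lt hj))

theorem exLimCof {μ : Cardinal.{0}} (hμ : μ.IsRegular) {l : Ordinal.{0}} (hl : μ < l.cof)
    {E : Set Ordinal.{0}} (hE : Clb E l) :
    ∃ δ < l, δ.cof = μ ∧ ∀ t < δ, ∃ e ∈ E, t < e ∧ e < δ := by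
  classical
  have h1 : ∀ x, ∃ y, x < y ∧ (x < l → y ∈ E ∧ y < l) := by
    intro x
    by_cases hx : x < l
    · obtain ⟨y, hy, h1, h2⟩ := hE.2 x hx
      exact ⟨y, h1, fun _ => ⟨hy, h2⟩⟩
    · exact ⟨x + 1, lt_add_one x, fun h => absurd h hx⟩
  choose st hst hst' using h1
  obtain ⟨ξ, hn, h1, h2⟩ := recLem2 (fun ξ j => st (ξ j))
    (fun ξ ξ' j h => by rw [h j le_rfl]) (fun ξ j => hst _)
  have h3 : ∀ i ≤ μ.ord, ξ i < l := by
    intro i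
    induction i using WellFoundedLT.induction with
    | _ i ih =>
    intro hi
    obtain ⟨b, hb, hb'⟩ := bddIio (o := i) (a := l) (f := fun j => st (ξ j))
      ((Ordinal.card_le_card hi).trans_lt (by simpa using hl))
      (fun j hj => (hst' _ (ih j hj (hj.le.trans hi))).2)
    exact (h2 i b fun j hj => (hb' j hj).le).trans_lt hb
  have hlim : Order.IsSuccLimit μ.ord := isSuccLimit_ord hμ.aleph0_le
  refine ⟨ξ μ.ord, h3 _ le_rfl, ?_, ?_⟩
  · rw [cof_map_of_isNormal hn hlim, hμ.cof_ord]
  · intro t ht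
    by_contra hcon
    push Not at hcon
    refine absurd ht (not_lt.2 (h2 _ _ fun j hj => ?_))
    by_contra hj'
    push Not at hj'
    have := hcon _ (hst' _ (h3 j hj.le)).1 hj'
    have h5 := h1 (Order.succ j) j (Order.lt_succ j)
    exact absurd (this.trans h5) (not_le.2 (hn.strictMono (hlim.succ_lt hj)))

theorem clubGuess {μ : Cardinal.{0}} (hμ : μ.IsRegular) (hμ0 : ℵ₀ < μ) :
    ∃ C : Ordinal.{0} → Set Ordinal.{0}, ∀ D, Clb D (Order.succ (Order.succ μ)).ord →
      ∃ δ < (Order.succ (Order.succ μ)).ord, δ.cof = μ ∧ C δ ⊆ D ∧ (∀ c ∈ C δ, c < δ) ∧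
        ∀ t < δ, ∃ c ∈ C δ, t < c := by
  classical
  set l := (Order.succ (Order.succ μ)).ord with hl
  have hreg1 : (Order.succ μ).IsRegular := isRegular_succ hμ.aleph0_le
  have hreg : (Order.succ (Order.succ μ)).IsRegular := isRegular_succ hreg1.aleph0_le
  have hcof : l.cof = Order.succ (Order.succ μ) := hreg.cof_ord
  have hμl : μ < l.cof := by rw [hcof]; exact (Order.lt_succ μ).trans (Order.lt_succ _)
  choose E0 hE1 hE2 hE3 using exCof
  let c : Ordinal.{0} → Set Ordinal.{0} := fun δ => limPts (E0 δ) ∩ Set.Iio δ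
  by_contra hcon
  have hD : ∀ E, ∃ D, Clb E l → Clb D l ∧ ∀ δ < l, δ.cof = μ →
      (∀ t < δ, ∃ x ∈ c δ ∩ E, t < x) → ∃ x ∈ c δ ∩ E, x ∉ D := by
    intro E
    by_contra hE
    push Not at hE
    apply hcon
    refine ⟨fun δ => c δ ∩ E, fun D hD => ?_⟩
    obtain ⟨hE, hE'⟩ := hE D
    obtain ⟨δ, h1, h2, h3, h4⟩ := hE' hD
    exact ⟨δ, h1, h2, h4, fun x hx => hx.1.2, h3⟩
  choose D hD using hD
  let F : (i : Ordinal.{0}) → ((j : Ordinal.{0}) → j < i → Set Ordinal.{0}) → Set Ordinal.{0} :=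
    fun i r => {x | ∀ j (h : j < i), x ∈ D (r j h)}
  let E : Ordinal.{0} → Set Ordinal.{0} :=
    WellFounded.fix (C := fun _ => Set Ordinal.{0}) (wellFounded_lt (α := Ordinal.{0})) F
  have hE : ∀ i, E i = {x | ∀ j ∈ Set.Iio i, x ∈ D (E j)} := by
    intro i
    change WellFounded.fix _ _ _ = _
    rw [WellFounded.fix_eq]
    rfl
  have hcl : ∀ i ≤ (Order.succ μ).ord, Clb (E i) l := by
    intro i
    induction i using WellFoundedLT.induction with
    | _ i ih =>
    intro hi
    rw [hE i]
    refine Clb.inter (hμ0.trans hμl) ?_ fun j hj => (hD (E j) (ih j hj (le_of_lt hj |>.trans hi))).1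
    rw [Cardinal.mk_Iio_ordinal, Cardinal.lift_lt]
    refine (Ordinal.card_le_card hi).trans_lt ?_
    rw [card_ord, hcof]
    exact Order.lt_succ _
  have hanti : ∀ i j, i ≤ j → E j ⊆ E i := by
    intro i j hij x hx
    rw [hE] at hx ⊢
    exact fun k hk => hx k (lt_of_lt_of_le hk hij)
  obtain ⟨δ, hδ, hδc, hδE⟩ := exLimCof hμ hμl (hcl _ le_rfl)
  have hδ0 : ℵ₀ < δ.cof := by rw [hδc]; exact hμ0
  have hub : ∀ t < δ, ∃ x ∈ c δ ∩ E (Order.succ μ).ord, t < x := by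
    have hc1 : Clb (limPts (E0 δ)) δ := clb_limPts hδ0 (hE1 δ) (hE3 δ)
    have hc2 : Clb (E (Order.succ μ).ord) δ :=
      ⟨fun β hβ h0 h => (hcl _ le_rfl).1 β (hβ.trans hδ) h0 h, fun x hx => hδE x hx⟩
    have := Clb.inter hδ0 (T := {0, 1}) (D := fun i => if i = 0 then limPts (E0 δ) else
      E (Order.succ μ).ord) (by
        refine lt_of_lt_of_le (b := ℵ₀) ?_ (by
          rw [← Cardinal.lift_aleph0.{1,0}]; exact Cardinal.lift_le.2 hδ0.le)
        exact (Set.toFinite _).lt_aleph0) (by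
        intro i hi
        rcases hi with rfl | rfl
        · simpa using hc1
        · simpa using hc2)
    intro t ht
    obtain ⟨y, hy, h1, h2⟩ := this.2 t ht
    refine ⟨y, ⟨⟨?_, h2⟩, ?_⟩, h1⟩
    · simpa using hy 0 (by simp)
    · simpa using hy 1 (by simp)
  have hx : ∀ i < (Order.succ μ).ord, ∃ x ∈ c δ ∩ E i, x ∉ D (E i) := by
    intro i hi
    refine (hD (E i) (hcl i hi.le)).2 δ hδ hδc ?_
    intro t ht
    obtain ⟨x, hx, h⟩ := hub t ht
    exact ⟨x, ⟨hx.1, hanti _ _ hi.le hx.2⟩, h⟩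
  choose! x hx hx' using hx
  have hne : ∀ i j, i < j → j < (Order.succ μ).ord → x i ≠ x j := by
    intro i j hij hj h
    have h1 := (hx j hj).2
    rw [hE j] at h1
    apply hx' i (hij.trans hj)
    rw [h]
    exact h1 i hij
  have hinj : Set.InjOn x (Set.Iio (Order.succ μ).ord) := by
    intro i hi j hj h
    rcases lt_trichotomy i j with h1 | h1 | h1
    · exact absurd h (hne _ _ h1 hj)
    · exact h1
    · exact absurd h.symm (hne _ _ h1 hi)
  have h1 : #(x '' Set.Iio (Order.succ μ).ord) ≤ #(c δ) :=
    mk_le_mk_of_subset (by rintro _ ⟨i, hi, rfl⟩; exact (hx i hi).1)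
  rw [mk_image_eq_of_injOn _ _ hinj, Cardinal.mk_Iio_ordinal, card_ord] at h1
  have h2 := h1.trans ((mk_limPts_le (hE3 δ)).trans (hE2 δ))
  rw [hδc, Cardinal.lift_le] at h2
  exact absurd h2 (not_le.2 (Order.lt_succ μ))


theorem star {I : Type} {L : Filter I} {α : Ordinal.{0}} {f : Ordinal.{0} → I → Ordinal.{0}}
    (inc : ∀ β γ, β < γ → γ < α → ∀ᶠ a in L, f β a < f γ a)
    {μ : Cardinal.{0}} (hμ : μ.IsRegular) (hμ0 : ℵ₀ < μ)
    (hν : Order.succ (Order.succ μ) < α.cof)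
    (H : ∀ Δ < α, ∃ E : Set Ordinal.{0}, (∀ e ∈ E, e < Δ) ∧ (∀ t < Δ, ∃ e ∈ E, t ≤ e) ∧
      ∃ Δ' < α, ∀ᶠ a in L, ∀ η ∈ limPts E, η < Δ → f η a ≤ f Δ' a)
    (N : Ordinal.{0} → Ordinal.{0}) (hN : ∀ β < α, N β < α) :
    ∃ (Y : Set Ordinal.{0}) (x : Ordinal.{0} → Ordinal.{0}) (Z : Ordinal.{0} → Set I),
      Cardinal.lift.{1} μ ≤ #Y ∧ (∀ y ∈ Y, ∃ z ∈ Y, y < z) ∧ (∀ y ∈ Y, x y < α ∧ Z y ∈ L) ∧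
      ∀ y ∈ Y, ∀ z ∈ Y, y < z → N (x y) ≤ x z ∧ ∀ a ∈ Z y, a ∈ Z z → f (x y) a < f (x z) a := by
  classical
  have hreg1 : (Order.succ μ).IsRegular := isRegular_succ hμ.aleph0_le
  have hreg : (Order.succ (Order.succ μ)).IsRegular := isRegular_succ hreg1.aleph0_le
  obtain ⟨C, hC⟩ := clubGuess hμ hμ0
  set l := (Order.succ (Order.succ μ)).ord with hl
  have hcof : l.cof = Order.succ (Order.succ μ) := hreg.cof_ord
  have hl0 : ℵ₀ < l.cof := by
    rw [hcof]; exact hμ0.trans ((Order.lt_succ μ).trans (Order.lt_succ _))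
  have hlim : Order.IsSuccLimit l := isSuccLimit_ord hreg.aleph0_le
  have hαlim : Order.IsSuccLimit α := by
    refine one_lt_cof_iff.1 (lt_of_lt_of_le (one_lt_aleph0.trans hl0) ?_)
    rw [hcof]; exact hν.le
  have hlc : l.card < α.cof := by rw [hl, card_ord]; exact hν
  -- the guess
  let Q : (Ordinal.{0} → Ordinal.{0}) → Ordinal.{0} → Ordinal.{0} → Ordinal.{0} → Prop :=
    fun ξ δ j s => ∀ᶠ a in L, ∀ k ∈ C δ, k ≤ j → f (ξ k) a < f s a
  have Qmono : ∀ ξ δ j s s', s ≤ s' → s' < α → Q ξ δ j s → Q ξ δ j s' := by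
    intro ξ δ j s s' hs hs' h
    rcases hs.eq_or_lt with rfl | hs
    · exact h
    filter_upwards [h, inc s s' hs hs'] with a h1 h2 k hk hkj
    exact (h1 k hk hkj).trans h2
  have hstep : ∀ (ξ : Ordinal.{0} → Ordinal.{0}) (j : Ordinal.{0}), ∃ s, ξ j < s ∧
      ((∀ k ≤ j, ξ k < α) → s < α ∧ N (ξ j) ≤ s ∧
        ∀ δ < l, (∃ σ < α, Q ξ δ j σ) → Q ξ δ j s) := by
    intro ξ j
    by_cases hξ : ∀ k ≤ j, ξ k < α
    · have : ∀ δ, ∃ σ < α, (∃ σ < α, Q ξ δ j σ) → Q ξ δ j σ := by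
        intro δ
        by_cases h : ∃ σ < α, Q ξ δ j σ
        · obtain ⟨σ, h1, h2⟩ := h
          exact ⟨σ, h1, fun _ => h2⟩
        · exact ⟨ξ j, hξ j le_rfl, fun h' => absurd h' h⟩
      choose σ hσ hσ' using this
      obtain ⟨b, hb, hb'⟩ := bddIio hlc (fun δ (_ : δ < l) => hσ δ)
      have hlt : max b (max (ξ j + 1) (N (ξ j))) < α :=
        max_lt hb (max_lt (hαlim.succ_lt (hξ j le_rfl)) (hN _ (hξ j le_rfl)))
      refine ⟨max b (max (ξ j + 1) (N (ξ j))), ?_, fun _ => ⟨hlt, ?_, ?_⟩⟩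
      · exact (lt_add_one _).trans_le ((le_max_left _ _).trans (le_max_right _ _))
      · exact (le_max_right _ _).trans (le_max_right _ _)
      · intro δ hδ h
        exact Qmono _ _ _ _ _ ((hb' δ hδ).le.trans (le_max_left _ _)) hlt (hσ' δ h)
    · exact ⟨ξ j + 1, lt_add_one _, fun h => absurd h hξ⟩
  choose G0 hG0 hG0' using hstep
  let R : (Ordinal.{0} → Ordinal.{0}) → Ordinal.{0} → Ordinal.{0} → Ordinal.{0} :=
    fun ξ j k => if k ≤ j then ξ k else 0
  have hR : ∀ ξ j k, k ≤ j → R ξ j k = ξ k := fun ξ j k h => if_pos h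
  obtain ⟨ξ, hn, h1, h2⟩ := recLem2 (fun ξ j => G0 (R ξ j) j) (by
      intro ξ ξ' j h
      have : R ξ j = R ξ' j := by
        funext k
        by_cases hk : k ≤ j
        · rw [hR _ _ _ hk, hR _ _ _ hk, h k hk]
        · simp [R, hk]
      simp only [this]) (by
      intro ξ j
      have := hG0 (R ξ j) j
      rwa [hR _ _ _ le_rfl] at this)
  have hsp : ∀ j, (∀ k ≤ j, ξ k < α) → G0 (R ξ j) j < α ∧ N (ξ j) ≤ G0 (R ξ j) j ∧
        ∀ δ < l, (∃ σ < α, Q ξ δ j σ) → Q ξ δ j (G0 (R ξ j) j) := by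
    intro j hj
    obtain ⟨ha, hb, hc⟩ := hG0' (R ξ j) j (fun k hk => by rw [hR _ _ _ hk]; exact hj k hk)
    rw [hR _ _ _ le_rfl] at hb
    have hQ : ∀ δ s, Q (R ξ j) δ j s ↔ Q ξ δ j s := by
      intro δ s
      refine Filter.eventually_congr (Filter.Eventually.of_forall fun a => ?_)
      refine forall_congr' fun k => forall_congr' fun hk => forall_congr' fun hkj => ?_
      rw [hR _ _ _ hkj]
    simp only [hQ] at hc
    exact ⟨ha, hb, hc⟩
  have hξα : ∀ i ≤ l, ξ i < α := by
    intro i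
    induction i using WellFoundedLT.induction with
    | _ i ih =>
    intro hi
    obtain ⟨b, hb, hb'⟩ := bddIio (o := i) (a := α) (f := fun j => G0 (R ξ j) j)
      ((Ordinal.card_le_card hi).trans_lt hlc)
      (fun j hj => (hsp j fun k hk => ih k (hk.trans_lt hj) ((hk.trans hj.le).trans hi)).1)
    exact (h2 i b fun j hj => (hb' j hj).le).trans_lt hb
  have hsp' : ∀ j < l, N (ξ j) ≤ G0 (R ξ j) j ∧
        ∀ δ < l, (∃ σ < α, Q ξ δ j σ) → Q ξ δ j (G0 (R ξ j) j) := fun j hj =>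
    (hsp j fun k hk => hξα k (hk.trans hj.le)).2
  have hmono := hn.strictMono
  obtain ⟨E, hE1, hE2, Δ', hΔ', hE3⟩ := H (ξ l) (hξα l le_rfl)
  -- below a limit
  have hbel : ∀ i, Order.IsSuccLimit i → ∀ t < ξ i, ∃ j < i, t < ξ j := by
    intro i hi t ht
    by_contra hcon
    push Not at hcon
    exact absurd ht (not_lt.2 ((hn.le_iff_forall_le hi).2 hcon))
  have hlimOf : ∀ β : Ordinal.{0}, 0 < β → (∀ x < β, ∃ y, x < y ∧ y < β) → Order.IsSuccLimit β := by
    intro β h0 h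
    rw [Order.isSuccLimit_iff]
    refine ⟨by simpa using h0.ne', ?_⟩
    refine Order.isSuccPrelimit_of_succ_lt ?_
    intro x hx
    obtain ⟨y, h3, h4⟩ := h x hx
    exact (Order.succ_le_of_lt h3).trans_lt h4
  have hD : Clb {i | ξ i ∈ limPts E} l := by
    constructor
    · intro β hβ h0 h t ht
      have hβl : Order.IsSuccLimit β := hlimOf β h0 (fun x hx => by
        obtain ⟨y, _, h⟩ := h x hx
        exact ⟨y, h⟩)
      obtain ⟨j, hj, htj⟩ := hbel β hβl t ht
      obtain ⟨y, hy, h3, h4⟩ := h j hj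
      obtain ⟨e, he, h5, h6⟩ := hy t (htj.trans (hmono h3))
      exact ⟨e, he, h5, h6.trans (hmono h4)⟩
    · intro x hx
      have hm : ∀ y < l, ∃ z, y < z ∧ z < l ∧ ∃ e ∈ E, ξ y < e ∧ e < ξ z := by
        intro y hy
        obtain ⟨e, he, h3⟩ := hE2 (ξ (Order.succ y)) (hmono (hlim.succ_lt hy))
        obtain ⟨z, hz, h4⟩ := hbel l hlim e (hE1 e he)
        refine ⟨z, ?_, hz, e, he, (hmono (Order.lt_succ y)).trans_le h3, h4⟩
        exact (Order.lt_succ y).trans (hmono.lt_iff_lt.1 (h3.trans_lt h4))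
      choose! m hm1 hm2 hm3 using hm
      obtain ⟨β, hβ, hxβ, h⟩ := iterLem hl0 m (fun y hy => ⟨hm1 y hy, hm2 y hy⟩) hx
      refine ⟨β, ?_, hxβ, hβ⟩
      intro t ht
      have hβl : Order.IsSuccLimit β := hlimOf β (bot_le.trans_lt hxβ) (fun x hx => by
        obtain ⟨y, h3, h4, _⟩ := h x hx
        exact ⟨y, h3, h4⟩)
      obtain ⟨j, hj, htj⟩ := hbel β hβl t ht
      obtain ⟨y, h3, h4, h5⟩ := h j hj
      obtain ⟨e, he, h6, h7⟩ := hm3 y (h4.trans hβ)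
      exact ⟨e, he, htj.trans ((hmono h3).trans h6), h7.trans (hmono h5)⟩
  obtain ⟨δ, hδ, hδc, hCD, hCδ, hCu⟩ := hC _ hD
  have hQ : ∀ j ∈ C δ, Q ξ δ j (ξ (Order.succ j)) := by
    intro j hj
    have hjl : j < l := (hCδ j hj).trans hδ
    refine Qmono _ _ _ _ _ (h1 _ _ (Order.lt_succ j)) (hξα _ (hlim.succ_lt hjl).le) ?_
    refine (hsp' j hjl).2 δ hδ ⟨Order.succ Δ', hαlim.succ_lt hΔ', ?_⟩
    filter_upwards [hE3, inc Δ' _ (Order.lt_succ Δ') (hαlim.succ_lt hΔ')] with a h3 h4 k hk _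
    exact (h3 _ (hCD hk) (hmono ((hCδ k hk).trans hδ))).trans_lt h4
  have hnomax : ∀ y ∈ C δ, ∃ z ∈ C δ, y < z := fun y hy => hCu y (hCδ y hy)
  let nx : Ordinal.{0} → Ordinal.{0} := fun y => sInf (C δ ∩ Set.Ioi y)
  have hnx : ∀ y ∈ C δ, nx y ∈ C δ ∩ Set.Ioi y := by
    intro y hy
    obtain ⟨z, hz, h⟩ := hnomax y hy
    exact csInf_mem ⟨z, hz, h⟩
  refine ⟨C δ, fun k => ξ (Order.succ k), fun k => {a | (∀ k' ∈ C δ, k' ≤ k → f (ξ k') a <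
    f (ξ (Order.succ k)) a) ∧ f (ξ (Order.succ k)) a ≤ f (ξ (nx k)) a}, ?_, hnomax, ?_, ?_⟩
  · by_contra hcon
    rw [not_le, ← hδc] at hcon
    obtain ⟨b, hb, hb'⟩ := bddSet hcon hCδ
    obtain ⟨c, hc, h⟩ := hCu b hb
    exact absurd h (hb' c hc).not_gt
  · intro y hy
    have hyl : y < l := (hCδ y hy).trans hδ
    refine ⟨hξα _ (hlim.succ_lt hyl).le, ?_⟩
    obtain ⟨h3, h4⟩ := hnx y hy
    refine Filter.inter_mem (hQ y hy) ?_
    rcases (Order.succ_le_of_lt (show y < nx y from h4)).eq_or_lt with h5 | h5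
    · filter_upwards with a
      exact (congrArg (fun t => f (ξ t) a) h5).le
    · filter_upwards [inc _ _ (hmono h5) (hξα _ ((hCδ _ h3).trans hδ).le)] with a h
      exact h.le
  · intro y hy z hz hyz
    constructor
    · have hyl : Order.succ y < l := hlim.succ_lt ((hCδ y hy).trans hδ)
      refine ((hsp' _ hyl).1.trans (h1 (Order.succ (Order.succ y)) _ (Order.lt_succ _))).trans ?_
      exact hmono.monotone (Order.succ_le_succ (Order.succ_le_of_lt hyz))
    · intro a ha1 ha2
      refine ha1.2.trans_lt (ha2.1 _ (hnx y hy).1 ?_)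
      exact csInf_le' ⟨hz, hyz⟩


def StarC {I : Type} (L : Filter I) (α : Ordinal.{0}) (f : Ordinal.{0} → I → Ordinal.{0})
    (μ : Cardinal.{0}) : Prop :=
  ∀ (N : Ordinal.{0} → Ordinal.{0}), (∀ β < α, N β < α) →
    ∃ (Y : Set Ordinal.{0}) (x : Ordinal.{0} → Ordinal.{0}) (Z : Ordinal.{0} → Set I),
      Cardinal.lift.{1} μ ≤ #Y ∧ (∀ y ∈ Y, ∃ z ∈ Y, y < z) ∧ (∀ y ∈ Y, x y < α ∧ Z y ∈ L) ∧
      ∀ y ∈ Y, ∀ z ∈ Y, y < z → N (x y) ≤ x z ∧ ∀ a ∈ Z y, a ∈ Z z → f (x y) a < f (x z) a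

noncomputable def proj (S : Set Ordinal.{0}) (y : Ordinal.{0}) : Ordinal.{0} :=
  sInf (S ∩ Set.Ici y)

theorem proj_mem {S : Set Ordinal.{0}} {y t : Ordinal.{0}} (ht : t ∈ S) (hy : y ≤ t) :
    proj S y ∈ S ∧ y ≤ proj S y :=
  csInf_mem (s := S ∩ Set.Ici y) ⟨t, ht, hy⟩

theorem proj_le {S : Set Ordinal.{0}} {y t : Ordinal.{0}} (ht : t ∈ S) (hy : y ≤ t) :
    proj S y ≤ t := csInf_le' ⟨ht, hy⟩

theorem smallUnion {I : Type} {μ : Cardinal.{0}} (hμ : μ.IsRegular) (hI : #I < μ)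
    {S : I → Set Ordinal.{0}} (hS : ∀ a, #(S a) < Cardinal.lift.{1} μ) :
    #(⋃ a, S a) < Cardinal.lift.{1} μ := by
  have h := mk_iUnion_le_sum_mk_lift (f := S)
  rw [Cardinal.lift_uzero] at h
  refine h.trans_lt (sum_lt_lift_of_isRegular.{0,1} hμ.lift ?_ hS)
  exact Cardinal.lift_lt.2 hI

theorem BP {I : Type} {L : Filter I} {α : Ordinal.{0}} {f : Ordinal.{0} → I → Ordinal.{0}}
    (inc : ∀ β γ, β < γ → γ < α → ∀ᶠ a in L, f β a < f γ a)
    {μ : Cardinal.{0}} (hμ : μ.IsRegular) (hI : #I < μ) (hlim : ∀ β < α, Order.succ β < α)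
    (st : StarC L α f μ) {T : I → Ordinal.{0}} (hT : ∀ a, ∀ ξ < α, f ξ a < T a)
    {S : I → Set Ordinal.{0}} (hTS : ∀ a, T a ∈ S a) (hS : ∀ a, #(S a) < Cardinal.lift.{1} μ) :
    ∃ ξ < α, ∀ η < α, ∀ᶠ a in L, f η a < proj (S a) (f ξ a) := by
  classical
  by_contra hcon
  push Not at hcon
  have : ∀ ξ, ∃ η, ξ < α → η < α ∧ ∃ᶠ a in L, proj (S a) (f ξ a) ≤ f η a := by
    intro ξ
    by_cases h : ξ < α
    · obtain ⟨η, h1, h2⟩ := hcon ξ h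
      exact ⟨η, fun _ => ⟨h1, h2⟩⟩
    · exact ⟨0, fun h' => absurd h' h⟩
  choose N hN using this
  obtain ⟨Y, x, Z, hY, hnext, hx, hYZ⟩ := st (fun ξ => Order.succ (N ξ))
    (fun β hβ => hlim _ (hN β hβ).1)
  let nx : Ordinal.{0} → Ordinal.{0} := fun y => sInf (Y ∩ Set.Ioi y)
  have hnx : ∀ y ∈ Y, nx y ∈ Y ∧ y < nx y := by
    intro y hy
    obtain ⟨z, hz, hyz⟩ := hnext y hy
    exact csInf_mem (s := Y ∩ Set.Ioi y) ⟨z, hz, hyz⟩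
  have hnx2 : ∀ y, ∀ z ∈ Y, y < z → nx y ≤ z := fun y z hz hyz => csInf_le' ⟨hz, hyz⟩
  have : ∀ y : Y, ∃ a, a ∈ Z y ∧ a ∈ Z (nx y) ∧ proj (S a) (f (x y) a) < f (x (nx y)) a := by
    rintro ⟨y, hy⟩
    obtain ⟨h1, h2⟩ := hnx y hy
    have h3 := (hYZ y hy _ h1 h2).1
    have h4 := inc (N (x y)) (x (nx y)) (Order.succ_le_iff.1 h3) (hx _ h1).1
    obtain ⟨a, ha, h5, h6, h7⟩ := ((hN _ (hx y hy).1).2.and_eventually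
      (h4.and (Filter.Eventually.and (hx y hy).2 (hx _ h1).2))).exists
    exact ⟨a, h6, h7, ha.trans_lt h5⟩
  choose A hA1 hA2 hA3 using this
  have hfib : ∀ a, #((fun y : Y => y.1) '' (A ⁻¹' {a})) < Cardinal.lift.{1} μ := by
    intro a
    refine lt_of_le_of_lt mk_image_le (lt_of_le_of_lt ?_ (hS a))
    have hp : ∀ y : Y, proj (S a) (f (x y) a) ∈ S a ∧ f (x y) a ≤ proj (S a) (f (x y) a) :=
      fun y => proj_mem (hTS a) (hT a _ (hx y.1 y.2).1).le
    refine mk_le_of_injective (f := fun y : (A ⁻¹' {a}) =>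
      (⟨proj (S a) (f (x y) a), (hp y).1⟩ : S a)) ?_
    have key : ∀ y z : Y, A y = a → A z = a → y.1 < z.1 →
        proj (S a) (f (x y) a) < proj (S a) (f (x z) a) := by
      rintro y z rfl hz hyz
      have h1 := hnx y.1 y.2
      refine (hA3 y).trans_le (le_trans ?_ (hp z).2)
      rcases (hnx2 y.1 z z.2 hyz).eq_or_lt with h | h
      · rw [h]
      · exact ((hYZ _ h1.1 _ z.2 h).2 _ (hA2 y) (hz ▸ hA1 z)).le
    rintro ⟨y, hy⟩ ⟨z, hz⟩ hyz
    simp only [Subtype.mk.injEq] at hyz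
    rcases lt_trichotomy y.1 z.1 with h | h | h
    · exact absurd hyz (key y z hy hz h).ne
    · exact Subtype.ext (Subtype.ext h)
    · exact absurd hyz (key z y hz hy h).ne'
  have hall := smallUnion hμ hI hfib
  refine absurd hY (not_le.2 (lt_of_le_of_lt (mk_le_mk_of_subset ?_) hall))
  intro y hy
  exact Set.mem_iUnion.2 ⟨A ⟨y, hy⟩, ⟨y, hy⟩, rfl, rfl⟩


def IsEub {I : Type} (L : Filter I) (α : Ordinal.{0}) (f : Ordinal.{0} → I → Ordinal.{0})
    (μ : Cardinal.{0}) (T g : I → Ordinal.{0}) : Prop :=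
  (∀ a, g a ≤ T a) ∧ (∀ η < α, ∀ᶠ a in L, f η a < g a) ∧ (∀ᶠ a in L, μ ≤ (g a).cof) ∧
    ∀ k : I → Ordinal.{0}, (∀ᶠ a in L, k a < g a) → ∃ ξ < α, ∀ᶠ a in L, k a < f ξ a

theorem EUB_step {I : Type} {L : Filter I} {α : Ordinal.{0}} {f : Ordinal.{0} → I → Ordinal.{0}}
    (inc : ∀ β γ, β < γ → γ < α → ∀ᶠ a in L, f β a < f γ a)
    {μ : Cardinal.{0}} (hμ : μ.IsRegular) (hI : #I < μ) (hlim : ∀ β < α, Order.succ β < α)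
    (st : StarC L α f μ) {T : I → Ordinal.{0}} (hT : ∀ a, ∀ ξ < α, f ξ a < T a)
    (hno : ¬ ∃ g, IsEub L α f μ T g)
    (S : I → Set Ordinal.{0}) (hTS : ∀ a, T a ∈ S a) (hS : ∀ a, #(S a) < Cardinal.lift.{1} μ) :
    ∃ S' : I → Set Ordinal.{0}, (∀ a, S a ⊆ S' a) ∧ (∀ a, #(S' a) < Cardinal.lift.{1} μ) ∧
      ∃ ξ₀ < α, ∀ ξ, ξ₀ ≤ ξ → ξ < α → ∃ᶠ a in L, proj (S' a) (f ξ a) < proj (S a) (f ξ a) := by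
  classical
  obtain ⟨ξ₀, hξ₀, hb⟩ := BP inc hμ hI hlim st hT hTS hS
  let g : I → Ordinal.{0} := fun a => proj (S a) (f ξ₀ a)
  have hg : ∀ a, g a ∈ S a := fun a => (proj_mem (hTS a) (hT a _ hξ₀).le).1
  have hge : ∀ ξ, ξ₀ ≤ ξ → ξ < α → ∀ᶠ a in L, f ξ a < g a ∧ g a = proj (S a) (f ξ a) := by
    intro ξ h1 h2
    have h3 : ∀ᶠ a in L, f ξ₀ a ≤ f ξ a := by
      rcases h1.eq_or_lt with h | h
      · rw [h]; exact Filter.Eventually.of_forall fun _ => le_rfl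
      · exact (inc _ _ h h2).mono fun _ h => h.le
    filter_upwards [hb ξ h2, h3] with a h4 h5
    refine ⟨h4, le_antisymm ?_ (proj_le (hg a) h4.le)⟩
    have h6 := proj_mem (hTS a) (hT a ξ h2).le
    exact proj_le h6.1 (h5.trans h6.2)
  by_cases hc : ∀ᶠ a in L, μ ≤ (g a).cof
  · have : ∃ k : I → Ordinal.{0}, (∀ᶠ a in L, k a < g a) ∧ ∀ ξ < α, ∃ᶠ a in L, f ξ a ≤ k a := by
      by_contra hk
      refine hno ⟨g, fun a => proj_le (hTS a) (hT a _ hξ₀).le, hb, hc, ?_⟩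
      intro k hk1
      by_contra hk2
      refine hk ⟨k, hk1, ?_⟩
      intro ξ hξ hh
      exact hk2 ⟨ξ, hξ, hh.mono fun a h => not_le.1 h⟩
    obtain ⟨k, hk1, hk2⟩ := this
    refine ⟨fun a => insert (k a) (S a), fun a => Set.subset_insert _ _, ?_, ξ₀, hξ₀, ?_⟩
    · intro a
      refine mk_insert_le.trans_lt (add_lt_of_lt hμ.lift.aleph0_le (hS a) ?_)
      exact one_lt_aleph0.trans_le hμ.lift.aleph0_le
    · intro ξ h1 h2
      refine ((hk2 ξ h2).and_eventually (hk1.and (hge ξ h1 h2))).mono ?_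
      rintro a ⟨h3, h4, h5, h6⟩
      rw [← h6]
      exact (proj_le (Set.mem_insert _ _) h3).trans_lt h4
  · choose E hE1 hE2 hE3 using fun a => exCof (g a)
    refine ⟨fun a => S a ∪ (if (g a).cof < μ then E a else ∅), fun a => Set.subset_union_left,
      ?_, ξ₀, hξ₀, ?_⟩
    · intro a
      refine (mk_union_le _ _).trans_lt (add_lt_of_lt hμ.lift.aleph0_le (hS a) ?_)
      split_ifs with h
      · exact (hE2 a).trans_lt (Cardinal.lift_lt.2 h)
      · simpa using hμ.pos
    · intro ξ h1 h2
      have hc' : ∃ᶠ a in L, (g a).cof < μ := by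
        intro hh
        exact hc (hh.mono fun a h => not_lt.1 h)
      refine (hc'.and_eventually (hge ξ h1 h2)).mono ?_
      rintro a ⟨h3, h5, h6⟩
      rw [← h6]
      obtain ⟨e, he, h7⟩ := hE3 a _ h5
      refine (proj_le (Set.mem_union_right _ ?_) h7).trans_lt (hE1 a e he)
      rwa [if_pos h3]

theorem EUB {I : Type} {L : Filter I} {α : Ordinal.{0}} {f : Ordinal.{0} → I → Ordinal.{0}}
    (inc : ∀ β γ, β < γ → γ < α → ∀ᶠ a in L, f β a < f γ a)
    {μ : Cardinal.{0}} (hμ : μ.IsRegular) (hI0 : ℵ₀ ≤ #I) (hI : #I < μ)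
    (hlim : ∀ β < α, Order.succ β < α) (hcof : μ < α.cof)
    (st : StarC L α f μ) {T : I → Ordinal.{0}} (hT : ∀ a, ∀ ξ < α, f ξ a < T a) :
    ∃ g, IsEub L α f μ T g := by
  classical
  by_contra hno
  have step : ∀ S : I → Set Ordinal.{0}, ∃ (S' : I → Set Ordinal.{0}) (ξ₀ : Ordinal.{0}),
      (∀ a, T a ∈ S a) → (∀ a, #(S a) < Cardinal.lift.{1} μ) →
      (∀ a, S a ⊆ S' a) ∧ (∀ a, #(S' a) < Cardinal.lift.{1} μ) ∧
      ξ₀ < α ∧ ∀ ξ, ξ₀ ≤ ξ → ξ < α → ∃ᶠ a in L, proj (S' a) (f ξ a) < proj (S a) (f ξ a) := by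
    intro S
    by_cases h : (∀ a, T a ∈ S a) ∧ (∀ a, #(S a) < Cardinal.lift.{1} μ)
    · obtain ⟨S', h1, h2, ξ₀, h3, h4⟩ := EUB_step inc hμ hI hlim st hT hno S h.1 h.2
      exact ⟨S', ξ₀, fun _ _ => ⟨h1, h2, h3, h4⟩⟩
    · exact ⟨S, 0, fun h1 h2 => absurd ⟨h1, h2⟩ h⟩
  choose X ξ₀ hX using step
  obtain ⟨S, hSeq⟩ : ∃ S : Ordinal.{0} → I → Set Ordinal.{0}, ∀ β a,
      S β a = insert (T a) (⋃ γ : Set.Iio β, X (S γ) a) := by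
    let F : (i : Ordinal.{0}) → ((j : Ordinal.{0}) → j < i → I → Set Ordinal.{0}) →
      I → Set Ordinal.{0} := fun i r a => insert (T a) (⋃ γ : Set.Iio i, X (r γ.1 γ.2) a)
    refine ⟨WellFounded.fix (C := fun _ => I → Set Ordinal.{0})
      (wellFounded_lt (α := Ordinal.{0})) F, ?_⟩
    intro β a
    rw [WellFounded.fix_eq]
  have hTS : ∀ β a, T a ∈ S β a := fun β a => by rw [hSeq]; exact Set.mem_insert _ _
  have hsub : ∀ γ β, γ < β → ∀ a, X (S γ) a ⊆ S β a := by
    intro γ β h a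
    rw [hSeq β]
    exact (Set.subset_iUnion (fun γ : Set.Iio β => X (S γ) a) ⟨γ, h⟩).trans (Set.subset_insert _ _)
  let Λ : Ordinal.{0} := (Order.succ #I).ord
  have hΛc : Λ.cof = Order.succ #I := (isRegular_succ hI0).cof_ord
  have hΛμ : Order.succ #I ≤ μ := Order.succ_le_of_lt hI
  have hΛl : ∀ β < Λ, Order.succ β < Λ := fun β hβ =>
    (isSuccLimit_ord (isRegular_succ hI0).aleph0_le).succ_lt hβ
  have hsm : ∀ β < Λ, ∀ a, #(S β a) < Cardinal.lift.{1} μ := by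
    intro β
    induction β using WellFoundedLT.induction with
    | _ β ih =>
      intro hβ a
      rw [hSeq]
      refine mk_insert_le.trans_lt (add_lt_of_lt hμ.lift.aleph0_le ?_
        (one_lt_aleph0.trans_le hμ.lift.aleph0_le))
      rw [card_iUnion_lt_iff_forall_of_isRegular hμ.lift]
      · rintro ⟨γ, hγ⟩
        exact (hX (S γ) (hTS γ) (ih γ hγ (lt_trans hγ hβ))).2.1 a
      · rw [Cardinal.mk_Iio_ordinal]
        exact Cardinal.lift_lt.2 ((lt_ord.1 hβ).trans_le hΛμ)
  have hX' := fun β hβ => hX (S β) (hTS β) (hsm β hβ)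
  have hmono : ∀ γ β, γ < β → β < Λ → ∀ a, S γ a ⊆ S β a := fun γ β h hβ a =>
    ((hX' γ (h.trans hβ)).1 a).trans (hsub γ β h a)
  obtain ⟨ξ, hξ, hξ'⟩ := bddIio (o := Λ) (a := α) (f := fun β => ξ₀ (S β))
    (by rw [card_ord]; exact hΛμ.trans_lt hcof) (fun β hβ => (hX' β hβ).2.2.1)
  have hpa : ∀ a, ∃ β < Λ, ∀ β' < Λ, proj (S β a) (f ξ a) ≤ proj (S β' a) (f ξ a) := by
    intro a
    have hne : ((fun β => proj (S β a) (f ξ a)) '' Set.Iio Λ).Nonempty :=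
      ⟨_, 0, (isRegular_succ hI0).ord_pos, rfl⟩
    obtain ⟨β, hβ, hβe⟩ := csInf_mem hne
    refine ⟨β, hβ, fun β' hβ' => ?_⟩
    have := csInf_le' (s := ((fun β => proj (S β a) (f ξ a)) '' Set.Iio Λ)) ⟨β', hβ', rfl⟩
    simp only at hβe this
    rwa [← hβe] at this
  choose b hb hb' using hpa
  obtain ⟨β, hβ, hbβ⟩ := bddFam (a := Λ) (f := b) (by rw [hΛc]; exact Order.lt_succ _) hb
  obtain ⟨a, ha⟩ := ((hX' β hβ).2.2.2 ξ (hξ' β hβ).le hξ).exists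
  have h1 : proj (S β a) (f ξ a) ≤ proj (S (b a) a) (f ξ a) := by
    have := proj_mem (hTS (b a) a) (hT a ξ hξ).le
    exact proj_le (hmono _ _ (hbβ a) hβ a this.1) this.2
  have h2 := hb' a _ (hΛl β hβ)
  have h3 : proj (S (Order.succ β) a) (f ξ a) ≤ proj (X (S β) a) (f ξ a) := by
    have := proj_mem ((hX' β hβ).1 a (hTS β a)) (hT a ξ hξ).le
    exact proj_le (hsub _ _ (Order.lt_succ β) a this.1) this.2
  exact absurd ha (not_lt.2 (h1.trans (h2.trans h3)))


theorem eub_notGt {I : Type} {L : Filter I} {α : Ordinal.{0}} {f : Ordinal.{0} → I → Ordinal.{0}}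
    (inc : ∀ β γ, β < γ → γ < α → ∀ᶠ a in L, f β a < f γ a)
    {μ : Cardinal.{0}} (hα : 0 < α) (hlim : ∀ β < α, Order.succ β < α)
    {T g : I → Ordinal.{0}} (hg : IsEub L α f μ T g) : ∀ᶠ a in L, (g a).cof ≤ α.cof := by
  classical
  by_contra hcon
  have hfr : ∃ᶠ a in L, α.cof < (g a).cof := fun h => hcon (h.mono fun a h => not_lt.1 h)
  obtain ⟨-, hub, -, hex⟩ := hg
  obtain ⟨W, hW1, hW2, hW3⟩ := exCof α
  have : ∀ a, ∃ b, α.cof < (g a).cof → b < g a ∧ ∀ w ∈ W, f w a < g a → f w a < b := by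
    intro a
    by_cases h : α.cof < (g a).cof
    · obtain ⟨b, hb, hb'⟩ := bddSet (s := (fun w => f w a) '' {w ∈ W | f w a < g a}) (a := g a)
        (mk_image_le.trans_lt ((mk_le_mk_of_subset fun w h => h.1).trans_lt
          (hW2.trans_lt (Cardinal.lift_lt.2 h)))) (by rintro _ ⟨w, hw, rfl⟩; exact hw.2)
      exact ⟨b, fun _ => ⟨hb, fun w hw hw' => hb' _ ⟨w, ⟨hw, hw'⟩, rfl⟩⟩⟩
    · exact ⟨0, fun h' => absurd h' h⟩
  choose b hb using this
  obtain ⟨ξ, hξ, hk⟩ := hex (fun a => if α.cof < (g a).cof then b a else f 0 a) (by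
    filter_upwards [hub 0 hα] with a h
    split_ifs with h'
    · exact (hb a h').1
    · exact h)
  obtain ⟨w, hw, hξw⟩ := hW3 _ (hlim ξ hξ)
  obtain ⟨a, h1, h2, h3, h4⟩ := (hfr.and_eventually (hk.and
    ((inc ξ w (Order.succ_le_iff.1 hξw) (hW1 w hw)).and (hub w (hW1 w hw))))).exists
  rw [if_pos h1] at h2
  exact absurd (((hb a h1).2 w hw h4).trans h2) h3.asymm

theorem eub_ne {I : Type} {L : Filter I} {α : Ordinal.{0}} {f : Ordinal.{0} → I → Ordinal.{0}}
    (inc : ∀ β γ, β < γ → γ < α → ∀ᶠ a in L, f β a < f γ a)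
    {μ : Cardinal.{0}} (hα : 0 < α)
    {T g : I → Ordinal.{0}} (hg : IsEub L α f μ T g)
    {γ : Cardinal.{0}} (hI : #I < γ) (hγ : γ < α.cof) : ∀ᶠ a in L, (g a).cof ≠ γ := by
  classical
  by_contra hcon
  have hfr : ∃ᶠ a in L, (g a).cof = γ := hcon
  have hγc : γ.ord.cof = γ := by
    obtain ⟨a, rfl⟩ := hfr.exists
    exact cof_ord_cof _
  obtain ⟨-, hub, -, hex⟩ := hg
  choose e he1 he2 he3 using fun a => exFund (g a)
  have : ∀ η, ∃ ξ, η < γ.ord → ξ < α ∧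
      ∀ᶠ a in L, (if (g a).cof = γ then e a η else f 0 a) < f ξ a := by
    intro η
    by_cases h : η < γ.ord
    · obtain ⟨ξ, hξ, hk⟩ := hex (fun a => if (g a).cof = γ then e a η else f 0 a) (by
        filter_upwards [hub 0 hα] with a h0
        split_ifs with h'
        · exact he2 a _ (by rwa [h'])
        · exact h0)
      exact ⟨ξ, fun _ => ⟨hξ, hk⟩⟩
    · exact ⟨0, fun h' => absurd h' h⟩
  choose X hX using this
  obtain ⟨ξ, hξ, hξ'⟩ := bddIio (o := γ.ord) (a := α) (f := X) (by rwa [card_ord])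
    (fun η h => (hX η h).1)
  have : ∀ a, ∃ η < γ.ord, (g a).cof = γ → f ξ a < g a → f ξ a ≤ e a η := by
    intro a
    by_cases h : (g a).cof = γ ∧ f ξ a < g a
    · obtain ⟨i, hi, hi'⟩ := he3 a _ h.2
      exact ⟨i, by rwa [← h.1], fun _ _ => hi'⟩
    · exact ⟨0, by simpa using (hI.trans_le' zero_le), fun h1 h2 => absurd ⟨h1, h2⟩ h⟩
  choose η hη hη' using this
  obtain ⟨η₁, h1, h2⟩ := bddFam (a := γ.ord) (by rwa [hγc]) hη
  obtain ⟨a, h3, h4, h5, h6⟩ := (hfr.and_eventually ((hX η₁ h1).2.and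
    ((inc _ _ (hξ' η₁ h1) hξ).and (hub ξ hξ)))).exists
  rw [if_pos h3] at h4
  have h7 := he1 a _ _ (h2 a) (by rwa [h3])
  exact absurd (h7.trans (h4.trans h5)) (not_lt.2 (hη' a h3 h6))

theorem eub_cof {I : Type} {L : Filter I} {α : Ordinal.{0}} {f : Ordinal.{0} → I → Ordinal.{0}}
    (inc : ∀ β γ, β < γ → γ < α → ∀ᶠ a in L, f β a < f γ a)
    {μ : Cardinal.{0}} (hα : 0 < α) (hlim : ∀ β < α, Order.succ β < α)
    {T g : I → Ordinal.{0}} (hg : IsEub L α f μ T g) (hI : #I < μ)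
    {Θ : Ordinal.{0}} (hL : ∀ ρ < Θ, ∀ P : Ordinal.{0} → I → Prop,
      (∀ i < ρ, ∀ᶠ a in L, P i a) → ∀ᶠ a in L, ∀ i < ρ, P i a)
    (hν : α.cof < iterSucc μ Θ) : ∀ᶠ a in L, (g a).cof = α.cof := by
  let m := Cardinal.preAleph.symm μ
  have hm : Cardinal.preAleph m = μ := by simp [m]
  by_cases hνμ : α.cof < μ
  · filter_upwards [eub_notGt inc hα hlim hg, hg.2.2.1] with a h1 h2
    exact absurd (h2.trans h1) (not_le.2 hνμ)
  obtain ⟨ρ, hρ⟩ : ∃ ρ, α.cof = Cardinal.preAleph (m + ρ) := by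
    refine ⟨Cardinal.preAleph.symm α.cof - m, ?_⟩
    rw [Ordinal.add_sub_cancel_of_le]
    · simp
    · exact Cardinal.preAleph.symm.monotone (not_lt.1 hνμ)
  have hρΘ : ρ < Θ := by
    rw [hρ, iterSucc] at hν
    simpa [m] using hν
  have h := hL ρ hρΘ (fun i a => (g a).cof ≠ Cardinal.preAleph (m + i)) (by
    intro i hi
    refine eub_ne inc hα hg (hI.trans_le ?_) ?_
    · rw [← hm]; exact Cardinal.preAleph.monotone (by simp)
    · rw [hρ]; simpa using hi)
  filter_upwards [h, eub_notGt inc hα hlim hg, hg.2.2.1] with a h1 h2 h3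
  by_contra hne
  have h4 : (g a).cof < α.cof := lt_of_le_of_ne h2 hne
  let q := Cardinal.preAleph.symm (g a).cof
  have hq : Cardinal.preAleph q = (g a).cof := by simp [q]
  have hmq : m ≤ q := Cardinal.preAleph.symm.monotone h3
  refine h1 (q - m) ?_ ?_
  · rw [hρ, ← hq, Cardinal.preAleph_lt_preAleph] at h4
    rw [← Ordinal.add_sub_cancel_of_le hmq] at h4
    simpa using h4
  · rw [Ordinal.add_sub_cancel_of_le hmq, hq]

/-- Abstract goodness. -/
theorem eub_good {I : Type} {L : Filter I} {α : Ordinal.{0}} {f : Ordinal.{0} → I → Ordinal.{0}}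
    {μ : Cardinal.{0}} {T g : I → Ordinal.{0}} (hg : IsEub L α f μ T g) (hI : #I < α.cof)
    (hcof : ∀ᶠ a in L, (g a).cof = α.cof) (hT : ∀ a, 0 < T a) :
    ∃ G : Ordinal.{0} → I → Ordinal.{0}, (∀ ζ < α.cof.ord, ∀ a, G ζ a < T a) ∧
      (∀ᶠ a in L, ∀ ζ ζ', ζ < ζ' → ζ' < α.cof.ord → G ζ a < G ζ' a) ∧
      (∀ ζ < α.cof.ord, ∃ β < α, ∀ᶠ a in L, G ζ a < f β a) ∧
      (∀ β < α, ∃ ζ < α.cof.ord, ∀ᶠ a in L, f β a < G ζ a) := by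
  classical
  obtain ⟨hgT, hub, -, hex⟩ := hg
  choose e he1 he2 he3 using fun a => exFund (g a)
  refine ⟨fun ζ a => if (g a).cof = α.cof then e a ζ else 0, ?_, ?_, ?_, ?_⟩
  · intro ζ hζ a
    simp only
    split_ifs with h
    · exact (he2 a ζ (by rwa [h])).trans_le (hgT a)
    · exact hT a
  · filter_upwards [hcof] with a h ζ ζ' h1 h2
    rw [if_pos h, if_pos h]
    exact he1 a _ _ h1 (by rwa [h])
  · intro ζ hζ
    refine hex _ ?_
    filter_upwards [hcof] with a h
    rw [if_pos h]
    exact he2 a ζ (by rwa [h])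
  · intro β hβ
    have : ∀ a, ∃ η < α.cof.ord, (g a).cof = α.cof → f β a < g a → f β a ≤ e a η := by
      intro a
      by_cases h : (g a).cof = α.cof ∧ f β a < g a
      · obtain ⟨i, hi, hi'⟩ := he3 a _ h.2
        exact ⟨i, by rwa [← h.1], fun _ _ => hi'⟩
      · refine ⟨0, ?_, fun h1 h2 => absurd ⟨h1, h2⟩ h⟩
        rw [lt_ord, card_zero]
        exact hI.trans_le' zero_le
    choose η hη hη' using this
    obtain ⟨ζ, h1, h2⟩ := bddFam (a := α.cof.ord) (by rwa [cof_ord_cof]) hη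
    refine ⟨ζ, h1, ?_⟩
    filter_upwards [hcof, hub β hβ] with a h3 h4
    rw [if_pos h3]
    exact (hη' a h3 h4).trans_lt (he1 a _ _ (h2 a) (by rwa [h3]))


theorem mkto {Θ : Ordinal.{0}} (a : Θ.ToType) (h : (ToType.toOrd a).1 < Θ) :
    ToType.mk ⟨(ToType.toOrd a).1, h⟩ = a := ToType.mk.apply_symm_apply a

theorem evI {Θ : Ordinal.{0}} (h0 : 0 < Θ) {P : Ordinal.{0} → Prop} :
    (∀ᶠ a : Θ.ToType in Filter.atTop, P (ToType.toOrd a).1) ↔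
      ∃ j < Θ, ∀ i, j ≤ i → i < Θ → P i := by
  have : Nonempty Θ.ToType := nonempty_toType_iff.2 h0.ne'
  rw [Filter.eventually_atTop]
  constructor
  · rintro ⟨a, ha⟩
    refine ⟨(ToType.toOrd a).1, (ToType.toOrd a).2, fun i hi hi' => ?_⟩
    have := ha (ToType.mk ⟨i, hi'⟩) (by
      show a ≤ _
      rw [← ToType.mk.symm_apply_le]
      exact hi)
    simpa using this
  · rintro ⟨j, hj, h⟩
    refine ⟨ToType.mk ⟨j, hj⟩, fun b hb => h _ ?_ (ToType.toOrd b).2⟩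
    have : (⟨j, hj⟩ : Set.Iio Θ) ≤ ToType.toOrd b := by
      rw [ToType.toOrd, ToType.mk.le_symm_apply]
      exact hb
    exact this

theorem ptLT_iff {κ : Cardinal.{0}} {f g : Ordinal.{0} → Ordinal.{0}} :
    ptLT κ f g ↔ ∃ j < κ.ord.cof.ord, ∀ i, j ≤ i → i < κ.ord.cof.ord → f i < g i := by
  constructor
  · intro h
    obtain ⟨b, hb, hb'⟩ := bddSet (a := κ.ord.cof.ord) (by rwa [cof_ord_cof])
      (fun i (hi : i ∈ {i : Ordinal | i < κ.ord.cof.ord ∧ g i ≤ f i}) => hi.1)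
    refine ⟨b, hb, fun i h1 h2 => ?_⟩
    by_contra h3
    exact absurd (hb' i ⟨h2, not_lt.1 h3⟩) (not_lt.2 h1)
  · rintro ⟨j, hj, h⟩
    refine lt_of_le_of_lt (mk_le_mk_of_subset (t := Set.Iio j) ?_) ?_
    · rintro i ⟨h1, h2⟩
      by_contra h3
      exact absurd (h i (not_lt.1 h3) h1) (not_lt.2 h2)
    · rw [Cardinal.mk_Iio_ordinal]
      exact Cardinal.lift_lt.2 (lt_ord.1 hj)

theorem scale_bound {κ : Cardinal.{0}} (hsing : κ.ord.cof < κ)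
    {κs : Ordinal.{0} → Cardinal.{0}} {f : Ordinal → Ordinal → Ordinal}
    (hscale : IsScale κ κs f) {Δ : Ordinal.{0}} (hΔ : Δ < (Order.succ κ).ord) :
    ∃ E : Set Ordinal.{0}, (∀ e ∈ E, e < Δ) ∧ (∀ t < Δ, ∃ e ∈ E, t ≤ e) ∧
      ∃ Δ' < (Order.succ κ).ord, ∃ j < κ.ord.cof.ord, ∀ i, j ≤ i → i < κ.ord.cof.ord →
        ∀ η ∈ limPts E, η < Δ → f η i ≤ f Δ' i := by
  classical
  obtain ⟨hreg, hinc, hcofi, hprod, -, hdom⟩ := hscale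
  obtain ⟨E, hE1, hE2, hE3⟩ := exCof Δ
  refine ⟨E, hE1, hE3, ?_⟩
  have hcle : Δ.cof ≤ κ := (cof_le_card Δ).trans (Order.lt_succ_iff.1 (lt_ord.1 hΔ))
  have hc : Δ.cof < κ := by
    refine lt_of_le_of_ne hcle fun h => hsing.ne ?_
    rw [← h, cof_ord_cof]
  obtain ⟨i₀, hi₀, hlt⟩ := hcofi _ hc
  have : ∀ i, ∃ b, i < κ.ord.cof.ord → b < (κs i).ord ∧
      (i₀ ≤ i → ∀ η ∈ limPts E, η < Δ → f η i < b) := by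
    intro i
    by_cases h : i < κ.ord.cof.ord ∧ i₀ ≤ i
    · have hle : κs i₀ ≤ κs i := by
        rcases h.2.eq_or_lt with h' | h'
        · rw [h']
        · exact (hinc _ _ h' h.1).le
      obtain ⟨b, hb, hb'⟩ := bddSet (s := (fun η => f η i) '' (limPts E ∩ Set.Iio Δ))
        (a := (κs i).ord) (by
          refine mk_image_le.trans_lt ((mk_limPts_le hE3).trans_lt (hE2.trans_lt ?_))
          rw [(hreg i h.1).1.cof_ord]
          exact Cardinal.lift_lt.2 (hlt.trans_le hle))
        (by
          rintro _ ⟨η, hη, rfl⟩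
          exact hprod η (lt_trans hη.2 hΔ) i h.1)
      exact ⟨b, fun _ => ⟨hb, fun _ η h1 h2 => hb' _ ⟨η, ⟨h1, h2⟩, rfl⟩⟩⟩
    · exact ⟨0, fun h' => ⟨(hreg i h').1.ord_pos, fun h2 => absurd ⟨h', h2⟩ h⟩⟩
  choose b hb using this
  obtain ⟨Δ', hΔ', hlt'⟩ := hdom b (fun i hi => (hb i hi).1)
  obtain ⟨j, hj, h⟩ := ptLT_iff.1 hlt'
  refine ⟨Δ', hΔ', max i₀ j, max_lt hi₀ hj, fun i h1 h2 η h3 h4 => ?_⟩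
  exact (((hb i h2).2 ((le_max_left _ _).trans h1) η h3 h4).trans
    (h i ((le_max_right _ _).trans h1) h2)).le

theorem club_closed_under {κ : Cardinal.{0}} (hκ : ℵ₀ ≤ κ) (F : Ordinal.{0} → Ordinal.{0})
    (hF : ∀ δ < (Order.succ κ).ord, F δ < (Order.succ κ).ord) :
    IsClubIn {α | α < (Order.succ κ).ord ∧ ∀ δ < α, F δ < α} (Order.succ κ).ord := by
  have hreg := isRegular_succ hκ
  have hl := isSuccLimit_ord hreg.aleph0_le
  refine ⟨fun α h => h.1, ?_, ?_⟩
  · intro β hβ h0 hs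
    refine ⟨hβ, fun δ hδ => ?_⟩
    obtain ⟨c, hc, hδc⟩ := exists_lt_of_lt_csSup (by
      by_contra hne
      rw [Set.not_nonempty_iff_eq_empty] at hne
      rw [hne] at hs
      simp at hs
      exact h0.ne hs) (hs.symm ▸ hδ)
    exact (hc.1.2 δ hδc).trans hc.2
  · intro γ hγ
    have : ∀ y, ∃ m, y < (Order.succ κ).ord → (y < m ∧ m < (Order.succ κ).ord) ∧
        ∀ δ ≤ y, F δ < m := by
      intro y
      by_cases hy : y < (Order.succ κ).ord
      · have hy1 := hl.succ_lt hy
        obtain ⟨b, hb, hb'⟩ := bddIio (o := Order.succ y) (a := (Order.succ κ).ord) (f := F)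
          (by rw [hreg.cof_ord]; exact lt_ord.1 hy1)
          (fun δ hδ => hF δ (hδ.trans hy1))
        refine ⟨max b (Order.succ y), fun _ => ⟨⟨?_, max_lt hb hy1⟩, ?_⟩⟩
        · exact (Order.lt_succ y).trans_le (le_max_right _ _)
        · intro δ hδ
          exact (hb' δ (Order.lt_succ_iff.2 hδ)).trans_le (le_max_left _ _)
      · exact ⟨0, fun h => absurd h hy⟩
    choose m hm using this
    obtain ⟨β, hβ, hγβ, h⟩ := iterLem (δ := (Order.succ κ).ord)
      (by rw [hreg.cof_ord]; exact Order.lt_succ_iff.2 hκ) m (fun y hy => (hm y hy).1) hγ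
    refine ⟨β, ⟨hβ, fun δ hδ => ?_⟩, hγβ.le⟩
    obtain ⟨y, h1, h2, h3⟩ := h δ hδ
    exact ((hm y (h2.trans hβ)).2 δ h1.le).trans h3

theorem club_of_good_points (κ : Cardinal.{0})
    (hκ : ℵ₀ ≤ κ) (hsing : κ.ord.cof < κ)
    (κs : Ordinal.{0} → Cardinal.{0}) (f : Ordinal → Ordinal → Ordinal)
    (hscale : IsScale κ κs f) :
    ∃ C : Set Ordinal, IsClubIn C (Order.succ κ).ord ∧
      ∀ μ ν : Cardinal.{0}, μ.IsRegular → ν.IsRegular →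
        κ.ord.cof < μ → iterSucc μ 3 ≤ ν → ν < iterSucc μ κ.ord.cof.ord →
        iterSucc μ κ.ord.cof.ord ≤ κ →
        ∀ α ∈ C, α.cof = ν → GoodAt κ κs f α := by
  classical
  have hb : ∀ Δ, ∃ Δ', Δ < (Order.succ κ).ord → Δ' < (Order.succ κ).ord ∧
      ∃ E : Set Ordinal.{0}, (∀ e ∈ E, e < Δ) ∧ (∀ t < Δ, ∃ e ∈ E, t ≤ e) ∧
      ∃ j < κ.ord.cof.ord, ∀ i, j ≤ i → i < κ.ord.cof.ord →
        ∀ η ∈ limPts E, η < Δ → f η i ≤ f Δ' i := by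
    intro Δ
    by_cases h : Δ < (Order.succ κ).ord
    · obtain ⟨E, h1, h2, Δ', h3, h4⟩ := scale_bound hsing hscale h
      exact ⟨Δ', fun _ => ⟨h3, E, h1, h2, h4⟩⟩
    · exact ⟨0, fun h' => absurd h' h⟩
  choose F hF using hb
  refine ⟨_, club_closed_under hκ F (fun δ hδ => (hF δ hδ).1), ?_⟩
  rintro μ ν hμ hν hθμ h3 hνlt - α ⟨hα, hαF⟩ rfl
  obtain ⟨hreg, hinc, hcofi, hprod, hincf, hdom⟩ := hscale
  have hθ : κ.ord.cof.IsRegular := isRegular_cof (isSuccLimit_ord hκ)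
  have hΘ0 : 0 < κ.ord.cof.ord := hθ.ord_pos
  have hαl : Order.IsSuccLimit α :=
    one_lt_cof_iff.1 (one_lt_aleph0.trans_le hν.aleph0_le)
  have hα0 : 0 < α := hαl.bot_lt
  have hlim : ∀ β < α, Order.succ β < α := fun β hβ => hαl.succ_lt hβ
  have hμα2 : Order.succ (Order.succ μ) < α.cof := by
    refine lt_of_lt_of_le ?_ h3
    obtain ⟨m, rfl⟩ := Cardinal.preAleph.surjective μ
    simp only [iterSucc, OrderIso.symm_apply_apply]
    rw [Cardinal.succ_preAleph, Cardinal.succ_preAleph, Cardinal.preAleph_lt_preAleph]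
    have : (3 : Ordinal.{0}) = 1 + 1 + 1 := by norm_num
    rw [this, ← add_assoc, ← add_assoc]
    exact lt_add_one _
  have hμα : μ < α.cof := (Order.lt_succ μ).trans ((Order.lt_succ _).trans hμα2)
  let I := κ.ord.cof.ord.ToType
  have hI : #I = κ.ord.cof := mk_ord_toType _
  let L : Filter I := Filter.atTop
  let f' : Ordinal.{0} → I → Ordinal.{0} := fun ξ a => f ξ (ToType.toOrd a).1
  let T : I → Ordinal.{0} := fun a => (κs (ToType.toOrd a).1).ord
  have inc : ∀ β γ, β < γ → γ < α → ∀ᶠ a in L, f' β a < f' γ a := by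
    intro β γ h1 h2
    exact (evI hΘ0 (P := fun i => f β i < f γ i)).2
      (ptLT_iff.1 (hincf β γ h1 (h2.trans hα)))
  have hT : ∀ a, ∀ ξ < α, f' ξ a < T a := fun a ξ hξ =>
    hprod ξ (hξ.trans hα) _ (ToType.toOrd a).2
  have st : StarC L α f' μ := by
    intro N hN
    refine star inc hμ (hθ.aleph0_le.trans_lt hθμ) hμα2 ?_ N hN
    intro Δ hΔ
    obtain ⟨-, E, h1, h2, h3⟩ := hF Δ (hΔ.trans hα)
    exact ⟨E, h1, h2, F Δ, hαF Δ hΔ,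
      (evI hΘ0 (P := fun i => ∀ η ∈ limPts E, η < Δ → f η i ≤ f (F Δ) i)).2 h3⟩
  obtain ⟨g, hg⟩ := EUB inc hμ (by rw [hI]; exact hθ.aleph0_le) (by rwa [hI]) hlim hμα st hT
  have hcof := eub_cof inc hα0 hlim hg (by rwa [hI]) (Θ := κ.ord.cof.ord) (by
    intro ρ hρ P hP
    have hP' : ∀ i, ∃ j < κ.ord.cof.ord, i < ρ → ∀ a : I, j ≤ (ToType.toOrd a).1 → P i a := by
      intro i
      by_cases hi : i < ρ
      · have := hP i hi
        have h2 : ∀ᶠ a : I in Filter.atTop, (fun o => ∀ h : o < κ.ord.cof.ord,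
            P i (ToType.mk ⟨o, h⟩)) (ToType.toOrd a).1 := by
          filter_upwards [this] with a ha h
          exact (mkto a h).symm ▸ ha
        obtain ⟨j, hj, h⟩ := (evI hΘ0 (P := fun o => ∀ h : o < κ.ord.cof.ord,
            P i (ToType.mk ⟨o, h⟩))).1 h2
        refine ⟨j, hj, fun _ a ha => ?_⟩
        have := h _ ha (ToType.toOrd a).2 (ToType.toOrd a).2
        exact mkto a _ ▸ this
      · exact ⟨0, hΘ0, fun h => absurd h hi⟩
    choose j hj hjP using hP'
    obtain ⟨b, hb, hb'⟩ := bddIio (o := ρ) (a := κ.ord.cof.ord) (f := j)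
      (by rw [cof_ord_cof]; exact lt_ord.1 hρ) (fun i _ => hj i)
    have h3 : ∀ᶠ a : I in Filter.atTop, b ≤ (ToType.toOrd a).1 :=
      (evI hΘ0 (P := fun i => b ≤ i)).2 ⟨b, hb, fun i h _ => h⟩
    filter_upwards [h3] with a ha i hi
    exact hjP i hi a ((hb' i hi).le.trans ha)) hνlt
  obtain ⟨G, hG1, hG2, hG3, hG4⟩ := eub_good hg (by rw [hI]; exact hθμ.trans hμα) hcof
    (fun a => (hreg _ (ToType.toOrd a).2).1.ord_pos)
  let G' : Ordinal.{0} → Ordinal.{0} → Ordinal.{0} := fun ζ i =>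
    if h : i < κ.ord.cof.ord then G ζ (ToType.mk ⟨i, h⟩) else 0
  have hGG : ∀ ζ a, G ζ a = G' ζ (ToType.toOrd a).1 := by
    intro ζ a
    have := (ToType.toOrd a).2
    simp only [Set.mem_Iio] at this
    simp only [G', this, dif_pos]
    exact congrArg (G ζ) (mkto a this).symm
  simp only [hGG] at hG1 hG2 hG3 hG4
  obtain ⟨j', hj', hG2'⟩ := (evI hΘ0 (P := fun i => ∀ ζ ζ', ζ < ζ' → ζ' < α.cof.ord →
    G' ζ i < G' ζ' i)).1 hG2
  refine ⟨G', j', hj', ?_, hG2', ?_, ?_⟩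
  · intro ζ hζ i hi
    have := hG1 ζ hζ (ToType.mk ⟨i, hi⟩)
    simpa [T] using this
  · intro ζ hζ
    obtain ⟨β, hβ, h⟩ := hG3 ζ hζ
    exact ⟨β, hβ, ptLT_iff.2 ((evI hΘ0 (P := fun i => G' ζ i < f β i)).1 h)⟩
  · intro β hβ
    obtain ⟨ζ, hζ, h⟩ := hG4 β hβ
    exact ⟨ζ, hζ, ptLT_iff.2 ((evI hΘ0 (P := fun i => f β i < G' ζ i)).1 h)⟩
end
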